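/- For partitions α, β of n and a composition ν of n, the number lr*(α,β;ν) of pairs (T,S) of Littlewood-Richardson multitableaux of shapes α and β, both of type ν, such that the content of S is the componentwise conjugate of the content of T, equals the inner product ⟨χ^α ⊗ χ^β ⊗ φ^ν, χ^(1^n)⟩, where χ^(1^n) is the sign character. -/

import Mathlib

open Finset Equiv
open scoped Classical

noncomputable section

/-- Value at `g` of the permutation character of `S_n` induced from the trivial character of
the Young subgroup of the composition `c`: the number of colorings of `Fin n` with fiber
sizes given by `c` that are fixed by `g`. -/
def permChar (n : ℕ) (c : ℕ → ℕ) (g : Perm (Fin n)) : ℚ :=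
  Nat.card {f : Fin n → ℕ // (∀ k, Nat.card {x : Fin n // f x = k} = c k) ∧ ∀ x, f (g x) = f x}

/-- Inner product of class functions (real-valued characters) of `S_n`. -/
def innerChar (n : ℕ) (χ ψ : Perm (Fin n) → ℚ) : ℚ :=
  (∑ g : Perm (Fin n), χ g * ψ g) / (n.factorial : ℚ)

/-- The trivial character `χ^{(n)}` of `S_n`. -/
def trivChar (n : ℕ) : Perm (Fin n) → ℚ := fun _ => 1

/-- The sign character `χ^{(1^n)}` of `S_n`. -/
def signChar (n : ℕ) : Perm (Fin n) → ℚ := fun g => ((Perm.sign g : ℤ) : ℚ)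

/-- Permutation character for an integer vector: zero if some entry is negative. -/
def permCharZ (n : ℕ) (c : ℕ → ℤ) (g : Perm (Fin n)) : ℚ :=
  if ∀ k, 0 ≤ c k then permChar n (fun k => (c k).toNat) g else 0

/-- The irreducible character `χ^a` of `S_n` indexed by the partition `a`, given by the
Jacobi–Trudi determinantal formula `χ^a = ∑_σ sgn(σ) φ^{(a_i - i + σ(i))_i}`. -/
def irrChar (n : ℕ) (a : ℕ → ℕ) (g : Perm (Fin n)) : ℚ :=
  ∑ σ : Perm (Fin n), ((Perm.sign σ : ℤ) : ℚ) *
    permCharZ n (fun i => if h : i < n then (a i : ℤ) - i + ((σ ⟨i, h⟩ : Fin n) : ℕ) else 0) g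

/-- Kronecker coefficient `k(a,b,c) = ⟨χ^a ⊗ χ^b, χ^c⟩`. -/
def kron (n : ℕ) (a b c : ℕ → ℕ) : ℚ :=
  innerChar n (fun g => irrChar n a g * irrChar n b g) (irrChar n c)

/-- Extend a vector indexed by `Fin p` to `ℕ` by zeros. -/
def extc {p : ℕ} (l : Fin p → ℕ) : ℕ → ℕ := fun i => if h : i < p then l ⟨i, h⟩ else 0

/-- Dominance order: `a ⊵ b`. -/
def Dominates (a b : ℕ → ℕ) : Prop :=
  ∀ k, ∑ i ∈ Finset.range k, b i ≤ ∑ i ∈ Finset.range k, a i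

/-- Conjugate (transpose) of a partition with at most `n` parts. -/
def conjFun (n : ℕ) (a : ℕ → ℕ) : ℕ → ℕ :=
  fun j => ((Finset.range n).filter (fun i => j < a i)).card

/-- `a` is a partition of `n` (weakly decreasing, supported on the first `n` parts). -/
def IsPartitionFun (n : ℕ) (a : ℕ → ℕ) : Prop :=
  (∀ i j, i ≤ j → a j ≤ a i) ∧ (∀ i, n ≤ i → a i = 0) ∧ ∑ i ∈ Finset.range n, a i = n

/-- The weakly decreasing sequence of parts of `P : Nat.Partition n`. -/
def pf {n : ℕ} (P : n.Partition) : ℕ → ℕ :=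
  fun i => ((P.parts.sort (· ≤ ·)).reverse).getD i 0

/-- The parts of `P : Nat.Partition n` as a vector of length `n`. -/
def pfin {n : ℕ} (P : n.Partition) : Fin n → ℕ := fun k => pf P k

/-- Number of cells of the skew shape `a/b` where the filling `T` has entry `k`. -/
def skewContent (a b : ℕ → ℕ) (T : ℕ → ℕ → ℕ) (k : ℕ) : ℕ :=
  Nat.card {p : ℕ × ℕ // b p.1 ≤ p.2 ∧ p.2 < a p.1 ∧ T p.1 p.2 = k}

/-- Number of cells of the skew shape `a/b`. -/
def skewSize (a b : ℕ → ℕ) : ℕ :=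
  Nat.card {p : ℕ × ℕ // b p.1 ≤ p.2 ∧ p.2 < a p.1}

/-- `T` is a semistandard filling of the shape `a` (zero outside, rows weakly increasing,
columns strictly increasing). -/
def IsSSYT (a : ℕ → ℕ) (T : ℕ → ℕ → ℕ) : Prop :=
  (∀ i j, a i ≤ j → T i j = 0) ∧
  (∀ i j₁ j₂, j₁ ≤ j₂ → j₂ < a i → T i j₁ ≤ T i j₂) ∧
  (∀ i₁ i₂ j, i₁ < i₂ → j < a i₂ → T i₁ j < T i₂ j)

/-- The Kostka number: the number of semistandard Young tableaux of shape `a`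
and content `c`. -/
def kostka (a c : ℕ → ℕ) : ℕ :=
  Nat.card {T : ℕ → ℕ → ℕ // IsSSYT a T ∧ ∀ k, skewContent a (fun _ => 0) T k = c k}

/-- Number of entries equal to `k` in the prefix of the (right-to-left, top-to-bottom)
reading word of `T` ending at position `(i,j)`. -/
def lrCount (a b : ℕ → ℕ) (T : ℕ → ℕ → ℕ) (i j k : ℕ) : ℕ :=
  Nat.card {p : ℕ × ℕ //
    (p.1 < i ∨ (p.1 = i ∧ j ≤ p.2)) ∧ b p.1 ≤ p.2 ∧ p.2 < a p.1 ∧ T p.1 p.2 = k}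

/-- `T` is a Littlewood–Richardson skew tableau of shape `a/b`: semistandard and its
reverse reading word is a lattice word. -/
def IsLR (a b : ℕ → ℕ) (T : ℕ → ℕ → ℕ) : Prop :=
  (∀ i j, ¬(b i ≤ j ∧ j < a i) → T i j = 0) ∧
  (∀ i j₁ j₂, b i ≤ j₁ → j₁ ≤ j₂ → j₂ < a i → T i j₁ ≤ T i j₂) ∧
  (∀ i₁ i₂ j, i₁ < i₂ → b i₁ ≤ j → j < a i₁ → b i₂ ≤ j → j < a i₂ → T i₁ j < T i₂ j) ∧
  (∀ i j k, lrCount a b T i j (k + 1) ≤ lrCount a b T i j k)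

/-- A Littlewood–Richardson multitableau of shape `α` with `r` parts: a chain of
partitions `0 = α(0) ⊆ α(1) ⊆ ⋯ ⊆ α(r) = α` together with Littlewood–Richardson
fillings of the successive skew shapes. -/
structure LRMultiF (r : ℕ) (α : ℕ → ℕ) where
  chain : Fin (r + 1) → ℕ → ℕ
  antitone : ∀ k i j, i ≤ j → chain k j ≤ chain k i
  zero : ∀ i, chain 0 i = 0
  last : ∀ i, chain (Fin.last r) i = α i
  mono : ∀ (k : Fin r) (i : ℕ), chain k.castSucc i ≤ chain k.succ i
  T : Fin r → ℕ → ℕ → ℕ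
  lr : ∀ k : Fin r, IsLR (chain k.succ) (chain k.castSucc) (T k)

/-- Content of the `k`-th tableau of a Littlewood–Richardson multitableau. -/
def LRMultiF.cont {r : ℕ} {α : ℕ → ℕ} (M : LRMultiF r α) (k : Fin r) : ℕ → ℕ :=
  skewContent (M.chain k.succ) (M.chain k.castSucc) (M.T k)

/-- Size of the `k`-th tableau of a Littlewood–Richardson multitableau. -/
def LRMultiF.size {r : ℕ} {α : ℕ → ℕ} (M : LRMultiF r α) (k : Fin r) : ℕ :=
  skewSize (M.chain k.succ) (M.chain k.castSucc)

/-- `LR(α,β;ν)`: pairs of Littlewood–Richardson multitableaux of shapes `α`, `β`,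
type `ν`, with equal contents. -/
def LRPairs (r : ℕ) (α β : ℕ → ℕ) (ν : Fin r → ℕ) :=
  {TS : LRMultiF r α × LRMultiF r β //
    (∀ k, TS.1.size k = ν k) ∧ (∀ k, TS.2.size k = ν k) ∧ ∀ k, TS.1.cont k = TS.2.cont k}

/-- `LR*(α,β;ν)`: pairs of Littlewood–Richardson multitableaux of shapes `α`, `β`,
type `ν`, with termwise conjugate contents. -/
def LRPairsStar (n r : ℕ) (α β : ℕ → ℕ) (ν : Fin r → ℕ) :=
  {TS : LRMultiF r α × LRMultiF r β //
    (∀ k, TS.1.size k = ν k) ∧ (∀ k, TS.2.size k = ν k) ∧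
      ∀ k m, TS.2.cont k m = conjFun n (TS.1.cont k) m}

/-- `lr(α,β;ν)`. -/
def lrNum (r : ℕ) (α β : ℕ → ℕ) (ν : Fin r → ℕ) : ℕ := Nat.card (LRPairs r α β ν)

/-- `lr*(α,β;ν)`. -/
def lrStarNum (n r : ℕ) (α β : ℕ → ℕ) (ν : Fin r → ℕ) : ℕ :=
  Nat.card (LRPairsStar n r α β ν)

/-- A semistandard Young tableau (of arbitrary partition shape). -/
structure SSYTP where
  shape : ℕ → ℕ
  T : ℕ → ℕ → ℕ
  antitone : ∀ i j, i ≤ j → shape j ≤ shape i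
  finite : ∃ N, ∀ i, N ≤ i → shape i = 0
  ssyt : IsSSYT shape T

/-- Content of a semistandard Young tableau. -/
def SSYTP.cont (P : SSYTP) : ℕ → ℕ := skewContent P.shape (fun _ => 0) P.T

/-- The multiset of entries of a matrix. -/
def entriesM {p q : ℕ} (A : Fin p → Fin q → ℕ) : Multiset ℕ :=
  (Finset.univ : Finset (Fin p × Fin q)).val.map (fun ij => A ij.1 ij.2)

/-- The π-sequence of `A` is the partition `ν` (the weakly decreasing rearrangement of
the entries of `A` is `ν`). -/
def HasPiSeq {p q : ℕ} (A : Fin p → Fin q → ℕ) {n : ℕ} (ν : n.Partition) : Prop :=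
  (entriesM A).filter (· ≠ 0) = ν.parts

end

noncomputable section

/-! ### Alternants -/

/-- A function on exponent vectors that changes sign under transpositions and vanishes on
vectors with a repeated entry. -/
structure IsAlternating {R : Type*} [CommRing R] {n : ℕ} (G : (Fin n → ℕ) → R) : Prop where
  swap : ∀ (l : Fin n → ℕ) (i j : Fin n), i ≠ j → G (l ∘ Equiv.swap i j) = -G l
  eq_zero : ∀ (l : Fin n → ℕ) (i j : Fin n), i ≠ j → l i = l j → G l = 0

/-- The alternant `det (v i ^ l j)`. -/
def alternant {R : Type*} [CommRing R] {n : ℕ} (v : Fin n → R) (l : Fin n → ℕ) : R :=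
  Matrix.det (Matrix.of fun i j => v i ^ l j)

theorem alternant_eq_sum {R : Type*} [CommRing R] {n : ℕ} (v : Fin n → R) (l : Fin n → ℕ) :
    alternant v l = ∑ σ : Perm (Fin n), ((Perm.sign σ : ℤ) : R) * ∏ i, v i ^ l (σ i) := by
  unfold alternant
  rw [← Matrix.det_transpose, Matrix.det_apply']
  simp

theorem alternant_comp {R : Type*} [CommRing R] {n : ℕ} (v : Fin n → R) (l : Fin n → ℕ)
    (σ : Perm (Fin n)) : alternant v (l ∘ σ) = ((Perm.sign σ : ℤ) : R) * alternant v l :=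
  Matrix.det_permute' σ (Matrix.of fun i j => v i ^ l j)

theorem isAlternating_alternant {R : Type*} [CommRing R] {n : ℕ} (v : Fin n → R) :
    IsAlternating (alternant v) where
  swap l i j hij := by
    rw [alternant_comp, Perm.sign_swap hij]; simp
  eq_zero l i j hij h := by
    unfold alternant
    exact Matrix.det_zero_of_column_eq hij (fun k => by simp [h])

theorem IsAlternating.const_mul {R : Type*} [CommRing R] {n : ℕ} {G : (Fin n → ℕ) → R}
    (hG : IsAlternating G) (r : R) : IsAlternating (fun l => r * G l) where
  swap l i j hij := by simp [hG.swap l i j hij]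
  eq_zero l i j hij h := by simp [hG.eq_zero l i j hij h]

/-- A finite set of exponent vectors stable under permutations of the entries. -/
def IsSymmSet {n : ℕ} (S : Finset (Fin n → ℕ)) : Prop :=
  ∀ (σ : Perm (Fin n)) (d : Fin n → ℕ), d ∈ S → d ∘ σ ∈ S

theorem IsSymmSet.sum_comp {R : Type*} [CommRing R] {n : ℕ} {S : Finset (Fin n → ℕ)}
    (hS : IsSymmSet S) (σ : Perm (Fin n)) (f : (Fin n → ℕ) → R) :
    ∑ d ∈ S, f (d ∘ σ) = ∑ d ∈ S, f d := by
  refine Finset.sum_nbij' (fun d => d ∘ σ) (fun d => d ∘ σ.symm) (fun d hd => hS σ d hd)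
    (fun d hd => hS _ d hd) ?_ ?_ (fun _ _ => rfl)
  · intro d _; ext i; simp
  · intro d _; ext i; simp

theorem alternant_mul_sum {R : Type*} [CommRing R] {n : ℕ} (v : Fin n → R) (l : Fin n → ℕ)
    {S : Finset (Fin n → ℕ)} (hS : IsSymmSet S) (w : (Fin n → ℕ) → R)
    (hw : ∀ (σ : Perm (Fin n)) d, w (d ∘ σ) = w d) :
    alternant v l * ∑ d ∈ S, w d * ∏ i, v i ^ d i = ∑ d ∈ S, w d * alternant v (l + d) := by
  simp only [alternant_eq_sum, Finset.mul_sum, Finset.sum_mul]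
  rw [Finset.sum_comm]
  conv_rhs => rw [Finset.sum_comm]
  refine Finset.sum_congr rfl fun σ _ => ?_
  rw [← hS.sum_comp σ]
  refine Finset.sum_congr rfl fun d _ => ?_
  rw [hw]
  simp only [Pi.add_apply, pow_add, Finset.prod_mul_distrib, Function.comp]
  ring

/-- The vectors of total `m`. -/
def hSet (n m : ℕ) : Finset (Fin n → ℕ) := Finset.piAntidiag Finset.univ m

/-- The zero-one vectors of total `m`. -/
def eSet (n m : ℕ) : Finset (Fin n → ℕ) := {d ∈ hSet n m | ∀ i, d i ≤ 1}

theorem mem_hSet {n m : ℕ} {d : Fin n → ℕ} : d ∈ hSet n m ↔ ∑ i, d i = m := by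
  simp [hSet, Finset.mem_piAntidiag]

theorem mem_eSet {n m : ℕ} {d : Fin n → ℕ} :
    d ∈ eSet n m ↔ ∑ i, d i = m ∧ ∀ i, d i ≤ 1 := by
  simp [eSet, mem_hSet]

theorem isSymmSet_hSet (n m : ℕ) : IsSymmSet (hSet n m) := by
  intro σ d hd
  rw [mem_hSet] at hd ⊢
  rw [← hd]
  exact Equiv.sum_comp σ d

theorem isSymmSet_eSet (n m : ℕ) : IsSymmSet (eSet n m) := by
  intro σ d hd
  rw [mem_eSet] at hd ⊢
  refine ⟨?_, fun i => hd.2 _⟩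
  rw [← hd.1]
  exact Equiv.sum_comp σ d

/-- The polynomial whose monomials have exponent vectors `S`. -/
def monoSum {R : Type*} [CommRing R] {n : ℕ} (v : Fin n → R) (S : Finset (Fin n → ℕ)) : R :=
  ∑ d ∈ S, ∏ i, v i ^ d i

theorem alternant_mul_prod_monoSum {R : Type*} [CommRing R] {n m : ℕ} (v : Fin n → R)
    (l : Fin n → ℕ) {S : Fin m → Finset (Fin n → ℕ)} (hS : ∀ k, IsSymmSet (S k)) :
    alternant v l * ∏ k, monoSum v (S k) =
      ∑ d ∈ Fintype.piFinset S, alternant v (l + ∑ k, d k) := by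
  simp only [monoSum, Finset.prod_univ_sum]
  simp only [alternant_eq_sum, Finset.mul_sum, Finset.sum_mul]
  rw [Finset.sum_comm]
  conv_rhs => rw [Finset.sum_comm]
  refine Finset.sum_congr rfl fun σ _ => ?_
  refine Finset.sum_nbij' (fun d k => d k ∘ σ.symm) (fun d k => d k ∘ σ) ?_ ?_ ?_ ?_ ?_
  · intro d hd
    rw [Fintype.mem_piFinset] at hd ⊢
    exact fun k => hS k _ _ (hd k)
  · intro d hd
    rw [Fintype.mem_piFinset] at hd ⊢
    exact fun k => hS k _ _ (hd k)
  · intro d _; ext k i; simp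
  · intro d _; ext k i; simp
  · intro d _
    simp only [Pi.add_apply, pow_add, Finset.prod_mul_distrib, Finset.sum_apply, Function.comp,
      Equiv.symm_apply_apply]
    rw [Finset.prod_comm]
    simp only [Finset.prod_pow_eq_pow_sum]
    ring

/-! ### Pieri rules -/

/-- Interlacing condition for a step from `l` to `l + d`, the horizontal strip condition. -/
def GoodH {n : ℕ} (l d : Fin n → ℕ) : Prop :=
  ∀ p q : Fin n, (q : ℕ) = p + 1 → l q + d q < l p

/-- The step from `l` to `l + d` preserves strict decrease. -/
def GoodE {n : ℕ} (l d : Fin n → ℕ) : Prop :=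
  ∀ p q : Fin n, (q : ℕ) = p + 1 → l q + d q < l p + d p

/-- Strictly decreasing vectors. -/
def IsStrictDecr {n : ℕ} (l : Fin n → ℕ) : Prop :=
  ∀ p q : Fin n, (q : ℕ) = p + 1 → l q < l p

/-- `x` is the last place where the step from `l` to `l + d` is not a horizontal strip. -/
def IsLastBad {n : ℕ} (l d : Fin n → ℕ) (x : Fin n × Fin n) : Prop :=
  (x.2 : ℕ) = x.1 + 1 ∧ l x.1 ≤ l x.2 + d x.2 ∧
    ∀ p q : Fin n, (q : ℕ) = p + 1 → x.1 < p → l q + d q < l p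

theorem IsLastBad.unique {n : ℕ} {l d : Fin n → ℕ} {x y : Fin n × Fin n}
    (hx : IsLastBad l d x) (hy : IsLastBad l d y) : x = y := by
  obtain ⟨hx1, hx2, hx3⟩ := hx
  obtain ⟨hy1, hy2, hy3⟩ := hy
  have : x.1 = y.1 := by
    rcases lt_trichotomy x.1 y.1 with h | h | h
    · exact absurd (hx3 _ _ hy1 h) (by omega)
    · exact h
    · exact absurd (hy3 _ _ hx1 h) (by omega)
  refine Prod.ext this (Fin.ext ?_)
  rw [hx1, hy1, this]

theorem exists_isLastBad {n : ℕ} {l d : Fin n → ℕ} (h : ¬GoodH l d) : ∃ x, IsLastBad l d x := by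
  have hne : ({x : Fin n × Fin n | (x.2 : ℕ) = x.1 + 1 ∧ l x.1 ≤ l x.2 + d x.2} :
      Finset (Fin n × Fin n)).Nonempty := by
    unfold GoodH at h
    push Not at h
    obtain ⟨p, q, h1, h2⟩ := h
    exact ⟨(p, q), by simp [h1, h2]⟩
  obtain ⟨x, hx, hmax⟩ := Finset.exists_max_image _ (fun x : Fin n × Fin n => x.1) hne
  simp only [Finset.mem_filter, Finset.mem_univ, true_and] at hx hmax
  refine ⟨x, hx.1, hx.2, fun p q hpq hlt => ?_⟩
  by_contra hcon
  exact absurd (hmax (p, q) ⟨hpq, by simpa using hcon⟩) (by simpa using hlt)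

/-- The step obtained from `d` by exchanging two entries of `l + d`. -/
def swapStep {n : ℕ} (l d : Fin n → ℕ) (x : Fin n × Fin n) : Fin n → ℕ :=
  fun j => (l + d) (Equiv.swap x.1 x.2 j) - l j

theorem add_swapStep {n : ℕ} {l d : Fin n → ℕ} (hl : IsStrictDecr l) {x : Fin n × Fin n}
    (hx : IsLastBad l d x) : l + swapStep l d x = (l + d) ∘ Equiv.swap x.1 x.2 := by
  obtain ⟨h1, h2, h3⟩ := hx
  have h4 := hl _ _ h1
  ext j
  simp only [swapStep, Pi.add_apply, Function.comp]
  rcases eq_or_ne j x.1 with rfl | hj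
  · rw [Equiv.swap_apply_left]; omega
  rcases eq_or_ne j x.2 with rfl | hj'
  · rw [Equiv.swap_apply_right]; omega
  · rw [Equiv.swap_apply_of_ne_of_ne hj hj']; omega

theorem IsLastBad.swapStep {n : ℕ} {l d : Fin n → ℕ} (hl : IsStrictDecr l)
    {x : Fin n × Fin n} (hx : IsLastBad l d x) : IsLastBad l (swapStep l d x) x := by
  have key := fun j => congrFun (add_swapStep hl hx) j
  simp only [Pi.add_apply, Function.comp] at key
  obtain ⟨h1, h2, h3⟩ := hx
  refine ⟨h1, ?_, fun p q hpq hlt => ?_⟩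
  · rw [key, Equiv.swap_apply_right]; omega
  · rw [key, Equiv.swap_apply_of_ne_of_ne]
    · exact h3 p q hpq hlt
    · rintro rfl; omega
    · rintro rfl; omega

theorem sum_add_eq_sum_goodH {R : Type*} [CommRing R] {n : ℕ} {G : (Fin n → ℕ) → R}
    (hG : IsAlternating G) {l : Fin n → ℕ} (hl : IsStrictDecr l) (m : ℕ) :
    ∑ d ∈ hSet n m, G (l + d) = ∑ d ∈ hSet n m with GoodH l d, G (l + d) := by
  rw [← Finset.sum_filter_add_sum_filter_not (hSet n m) (GoodH l), add_eq_left]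
  have hex : ∀ d ∈ (hSet n m).filter (fun d => ¬GoodH l d), ∃ x, IsLastBad l d x :=
    fun d hd => exists_isLastBad (Finset.mem_filter.1 hd).2
  have hne : ∀ {d : Fin n → ℕ} {x : Fin n × Fin n}, IsLastBad l d x → x.1 ≠ x.2 := by
    intro d x hx h
    have := hx.1
    rw [h] at this
    omega
  refine Finset.sum_involution (fun d hd => swapStep l d (hex d hd).choose) ?_ ?_ ?_ ?_
  · intro d hd
    rw [add_swapStep hl (hex d hd).choose_spec, hG.swap _ _ _ (hne (hex d hd).choose_spec)]
    simp
  · intro d hd h0 heq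
    apply h0
    have hx := (hex d hd).choose_spec
    have := add_swapStep hl hx
    rw [heq] at this
    refine hG.eq_zero _ _ _ (hne hx) ?_
    have h2 := congrFun this (hex d hd).choose.1
    simpa using h2
  · intro d hd
    have hx := (hex d hd).choose_spec
    rw [Finset.mem_filter]
    constructor
    · have h := (Finset.mem_filter.1 hd).1
      rw [mem_hSet] at h ⊢
      have h2 : ∑ i, (l + swapStep l d (hex d hd).choose) i = ∑ i, (l + d) i := by
        rw [add_swapStep hl hx]
        exact Equiv.sum_comp _ _
      simp only [Pi.add_apply, Finset.sum_add_distrib] at h2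
      omega
    · intro hgood
      obtain ⟨h1, h2, -⟩ := hx.swapStep hl
      exact absurd (hgood _ _ h1) (by omega)
  · intro d hd
    have hx := (hex d hd).choose_spec
    have hx' := hx.swapStep hl
    generalize_proofs p1 p2
    have : p2.choose = p1.choose := p2.choose_spec.unique hx'
    rw [this]
    have e1 := add_swapStep hl hx'
    rw [add_swapStep hl hx] at e1
    have e2 : ((l + d) ∘ Equiv.swap p1.choose.1 p1.choose.2) ∘
      Equiv.swap p1.choose.1 p1.choose.2 = l + d := by ext j; simp
    rw [e2] at e1
    exact add_left_cancel e1

theorem sum_add_eq_sum_goodE {R : Type*} [CommRing R] {n : ℕ} {G : (Fin n → ℕ) → R}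
    (hG : IsAlternating G) {l : Fin n → ℕ} (hl : IsStrictDecr l) (m : ℕ) :
    ∑ d ∈ eSet n m, G (l + d) = ∑ d ∈ eSet n m with GoodE l d, G (l + d) := by
  symm
  refine Finset.sum_filter_of_ne fun d hd h0 => ?_
  by_contra hcon
  unfold GoodE at hcon
  push Not at hcon
  obtain ⟨p, q, hpq, hle⟩ := hcon
  have h1 := hl p q hpq
  have h2 := (mem_eSet.1 hd).2 q
  refine h0 (hG.eq_zero _ p q ?_ ?_)
  · rintro rfl; omega
  · simp only [Pi.add_apply]; omega

theorem GoodH.isStrictDecr {n : ℕ} {l d : Fin n → ℕ} (h : GoodH l d) : IsStrictDecr (l + d) :=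
  fun p q hpq => (h p q hpq).trans_le (Nat.le_add_right _ _)

theorem GoodE.isStrictDecr {n : ℕ} {l d : Fin n → ℕ} (h : GoodE l d) : IsStrictDecr (l + d) :=
  h

/-- The sum of the first `k` steps. -/
def partialSum {n m : ℕ} (d : Fin m → Fin n → ℕ) (k : ℕ) : Fin n → ℕ :=
  ∑ j : Fin m, if (j : ℕ) < k then d j else 0

theorem partialSum_zero {n m : ℕ} (d : Fin m → Fin n → ℕ) : partialSum d 0 = 0 := by
  simp [partialSum]

theorem partialSum_of_le {n m : ℕ} (d : Fin m → Fin n → ℕ) {k : ℕ} (hk : m ≤ k) :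
    partialSum d k = ∑ j, d j := by
  unfold partialSum
  refine Finset.sum_congr rfl fun j _ => ?_
  rw [if_pos (by omega)]

theorem partialSum_succ {n m : ℕ} (d : Fin m → Fin n → ℕ) (k : Fin m) :
    partialSum d (k + 1) = partialSum d k + d k := by
  unfold partialSum
  rw [← Finset.sum_erase_add _ _ (Finset.mem_univ k),
    ← Finset.sum_erase_add (a := k) _ (fun j : Fin m => if (j : ℕ) < k then d j else 0)
      (Finset.mem_univ k)]
  simp only [lt_add_one, if_true, lt_irrefl, if_false, add_zero]
  congr 1
  refine Finset.sum_congr rfl fun j hj => ?_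
  have : (j : ℕ) ≠ k := fun h => (Finset.ne_of_mem_erase hj) (Fin.ext h)
  congr 1
  simp only [eq_iff_iff]
  omega

theorem partialSum_cons_succ {n m : ℕ} (d₀ : Fin n → ℕ) (d : Fin m → Fin n → ℕ) (k : ℕ) :
    partialSum (Fin.cons d₀ d : Fin (m + 1) → Fin n → ℕ) (k + 1) = d₀ + partialSum d k := by
  simp [partialSum, Fin.sum_univ_succ]

/-- All steps of the sequence `d`, started at `l`, satisfy `good`. -/
def AllGood {n m : ℕ} (good : (Fin n → ℕ) → (Fin n → ℕ) → Prop) (l : Fin n → ℕ)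
    (d : Fin m → Fin n → ℕ) : Prop :=
  ∀ k : Fin m, good (l + partialSum d k) (d k)

theorem allGood_cons {n m : ℕ} {good : (Fin n → ℕ) → (Fin n → ℕ) → Prop} {l : Fin n → ℕ}
    {d₀ : Fin n → ℕ} {d : Fin m → Fin n → ℕ} :
    AllGood good l (Fin.cons d₀ d : Fin (m + 1) → Fin n → ℕ) ↔
      good l d₀ ∧ AllGood good (l + d₀) d := by
  unfold AllGood
  rw [Fin.forall_fin_succ]
  simp [partialSum_zero, partialSum_cons_succ, add_assoc]

theorem sum_piFinset_succ {M : Type*} [AddCommMonoid M] {ι : Type*} {m : ℕ}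
    (S : Fin (m + 1) → Finset ι) (f : (Fin (m + 1) → ι) → M) :
    ∑ d ∈ Fintype.piFinset S, f d =
      ∑ d₀ ∈ S 0, ∑ d ∈ Fintype.piFinset (fun k : Fin m => S k.succ), f (Fin.cons d₀ d) := by
  rw [← Finset.sum_product']
  refine Finset.sum_nbij' (fun d => (d 0, Fin.tail d)) (fun x => Fin.cons x.1 x.2) ?_ ?_ ?_ ?_ ?_
  · intro d hd
    rw [Fintype.mem_piFinset] at hd
    simp only [Finset.mem_product, Fintype.mem_piFinset]
    exact ⟨hd 0, fun k => hd k.succ⟩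
  · intro x hx
    simp only [Finset.mem_product, Fintype.mem_piFinset] at hx
    rw [Fintype.mem_piFinset]
    intro k
    refine Fin.cases ?_ (fun k => ?_) k
    · simpa using hx.1
    · simpa using hx.2 k
  · intro d _; simp
  · intro x _; simp
  · intro d _; simp

/-- Iterated form of a one-step cancellation rule. -/
theorem sum_piFinset_eq_sum_allGood {R : Type*} [CommRing R] {n : ℕ}
    (S : ℕ → Finset (Fin n → ℕ)) (hS : ∀ c, IsSymmSet (S c))
    (good : (Fin n → ℕ) → (Fin n → ℕ) → Prop)
    (hdecr : ∀ l d, good l d → IsStrictDecr (l + d))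
    (hstep : ∀ (G : (Fin n → ℕ) → R), IsAlternating G → ∀ l, IsStrictDecr l → ∀ c,
      ∑ d ∈ S c, G (l + d) = ∑ d ∈ S c with good l d, G (l + d))
    {G : (Fin n → ℕ) → R} (hG : IsAlternating G) {m : ℕ} (c : Fin m → ℕ) {l : Fin n → ℕ}
    (hl : IsStrictDecr l) :
    ∑ d ∈ Fintype.piFinset (fun k => S (c k)), G (l + ∑ k, d k) =
      ∑ d ∈ Fintype.piFinset (fun k => S (c k)) with AllGood good l d, G (l + ∑ k, d k) := by
  induction m generalizing l with
  | zero =>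
    symm
    refine Finset.sum_filter_of_ne fun d _ _ k => k.elim0
  | succ m ih =>
    have halt : IsAlternating (fun l' => ∑ d ∈ Fintype.piFinset (fun k : Fin m => S (c k.succ)),
        G (l' + ∑ k, d k)) := by
      constructor
      · intro l' i j hij
        rw [← Finset.sum_neg_distrib]
        refine Finset.sum_nbij' (fun d k => d k ∘ Equiv.swap i j)
          (fun d k => d k ∘ Equiv.swap i j) ?_ ?_ ?_ ?_ ?_
        · intro d hd
          rw [Fintype.mem_piFinset] at hd ⊢
          exact fun k => hS _ _ _ (hd k)
        · intro d hd
          rw [Fintype.mem_piFinset] at hd ⊢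
          exact fun k => hS _ _ _ (hd k)
        · intro d _; ext k a; simp
        · intro d _; ext k a; simp
        · intro d _
          rw [← hG.swap _ i j hij]
          congr 1
          ext a
          simp
      · intro l' i j hij hl'
        refine Finset.sum_involution (fun d _ k => d k ∘ Equiv.swap i j) ?_ ?_ ?_ ?_
        · intro d _
          have : l' + ∑ k, d k ∘ Equiv.swap i j = (l' + ∑ k, d k) ∘ Equiv.swap i j := by
            ext a
            rcases eq_or_ne a i with rfl | hi
            · simp [hl']
            rcases eq_or_ne a j with rfl | hj
            · simp [hl']
            · simp [Equiv.swap_apply_of_ne_of_ne hi hj]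
          rw [this, hG.swap _ i j hij]
          simp
        · intro d _ h0 heq
          apply h0
          refine hG.eq_zero _ i j hij ?_
          have : ∀ k, d k i = d k j := by
            intro k
            have := congrFun (congrFun heq k) j
            simpa using this
          simp [hl', this]
        · intro d hd
          rw [Fintype.mem_piFinset] at hd ⊢
          exact fun k => hS _ _ _ (hd k)
        · intro d _; ext k a; simp
    rw [Finset.sum_filter, sum_piFinset_succ, sum_piFinset_succ]
    simp only [Fin.sum_univ_succ, Fin.cons_zero, Fin.cons_succ, ← add_assoc]
    rw [hstep _ halt l hl, Finset.sum_filter]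
    refine Finset.sum_congr rfl fun d₀ _ => ?_
    split_ifs with h0
    · rw [ih (fun k => c k.succ) (hdecr _ _ h0), Finset.sum_filter]
      refine Finset.sum_congr rfl fun d _ => ?_
      simp [allGood_cons, h0]
    · symm
      refine Finset.sum_eq_zero fun d _ => ?_
      rw [if_neg]
      rw [allGood_cons]
      exact fun h => h0 h.1

theorem sum_piFinset_hSet {R : Type*} [CommRing R] {n : ℕ} {G : (Fin n → ℕ) → R}
    (hG : IsAlternating G) {m : ℕ} (c : Fin m → ℕ) {l : Fin n → ℕ} (hl : IsStrictDecr l) :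
    ∑ d ∈ Fintype.piFinset (fun k => hSet n (c k)), G (l + ∑ k, d k) =
      ∑ d ∈ Fintype.piFinset (fun k => hSet n (c k)) with AllGood GoodH l d,
        G (l + ∑ k, d k) :=
  sum_piFinset_eq_sum_allGood (hSet n) (isSymmSet_hSet n) GoodH (fun _ _ h => h.isStrictDecr)
    (fun _ hG _ hl c => sum_add_eq_sum_goodH hG hl c) hG c hl

theorem sum_piFinset_eSet {R : Type*} [CommRing R] {n : ℕ} {G : (Fin n → ℕ) → R}
    (hG : IsAlternating G) {m : ℕ} (c : Fin m → ℕ) {l : Fin n → ℕ} (hl : IsStrictDecr l) :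
    ∑ d ∈ Fintype.piFinset (fun k => eSet n (c k)), G (l + ∑ k, d k) =
      ∑ d ∈ Fintype.piFinset (fun k => eSet n (c k)) with AllGood GoodE l d,
        G (l + ∑ k, d k) :=
  sum_piFinset_eq_sum_allGood (eSet n) (isSymmSet_eSet n) GoodE (fun _ _ h => h.isStrictDecr)
    (fun _ hG _ hl c => sum_add_eq_sum_goodE hG hl c) hG c hl

/-! ### Chains of horizontal strips and the cancellation of non-lattice chains -/

/-- `A` is a chain of `n` steps of decreasing vectors from `μ` to `α`. -/
structure IsShapeChain (n : ℕ) (μ α : ℕ → ℕ) (A : ℕ → ℕ → ℕ) : Prop where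
  init : ∀ i, A 0 i = μ i
  final : ∀ k i, n ≤ k → A k i = α i
  mono : ∀ k i, A k i ≤ A (k + 1) i
  anti : ∀ k i, A k (i + 1) ≤ A k i

theorem IsShapeChain.le_final {n : ℕ} {μ α : ℕ → ℕ} {A : ℕ → ℕ → ℕ} (h : IsShapeChain n μ α A)
    (k i : ℕ) : A k i ≤ α i := by
  rw [← h.final (max n k) i (le_max_left _ _)]
  exact monotone_nat_of_le_succ (fun k => h.mono k i) (le_max_right n k)

theorem IsShapeChain.init_le {n : ℕ} {μ α : ℕ → ℕ} {A : ℕ → ℕ → ℕ} (h : IsShapeChain n μ α A)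
    (k i : ℕ) : μ i ≤ A k i := by
  rw [← h.init i]
  exact monotone_nat_of_le_succ (fun k => h.mono k i) (Nat.zero_le k)

theorem finite_isShapeChain {n : ℕ} {μ α : ℕ → ℕ} (hα : ∀ i, n ≤ i → α i = 0) :
    {A | IsShapeChain n μ α A}.Finite := by
  let f : {A | IsShapeChain n μ α A} → (Fin n → (i : Fin n) → Fin (α i + 1)) :=
    fun A k i => ⟨A.1 k i, Nat.lt_succ_of_le (A.2.le_final k i)⟩
  have hf : Function.Injective f := by
    rintro ⟨A, hA⟩ ⟨B, hB⟩ hAB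
    ext k i
    have hA' : IsShapeChain n μ α A := hA
    have hB' : IsShapeChain n μ α B := hB
    change A k i = B k i
    by_cases hk : n ≤ k
    · rw [hA'.final k i hk, hB'.final k i hk]
    by_cases hi : n ≤ i
    · have h1 := hA'.le_final k i
      have h2 := hB'.le_final k i
      rw [hα i hi] at h1 h2
      omega
    have := congrFun (congrFun hAB ⟨k, by omega⟩) ⟨i, by omega⟩
    simpa [f] using this
  exact Set.finite_coe_iff.1 (Finite.of_injective f hf)

/-- The finite set of chains of `n` steps of decreasing vectors from `μ` to `α`. -/
def shapeChains (n : ℕ) (μ α : ℕ → ℕ) : Finset (ℕ → ℕ → ℕ) :=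
  if h : {A | IsShapeChain n μ α A}.Finite then h.toFinset else ∅

theorem mem_shapeChains {n : ℕ} {μ α : ℕ → ℕ} (hα : ∀ i, n ≤ i → α i = 0) {A : ℕ → ℕ → ℕ} :
    A ∈ shapeChains n μ α ↔ IsShapeChain n μ α A := by
  rw [shapeChains, dif_pos (finite_isShapeChain hα)]
  simp

/-- `A` is a chain of `n` horizontal strips from `μ` to `α`. -/
structure IsHChain (n : ℕ) (μ α : ℕ → ℕ) (A : ℕ → ℕ → ℕ) : Prop where
  init : ∀ i, A 0 i = μ i
  final : ∀ k i, n ≤ k → A k i = α i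
  mono : ∀ k i, A k i ≤ A (k + 1) i
  strip : ∀ k i, A (k + 1) (i + 1) ≤ A k i

theorem IsHChain.antitone {n : ℕ} {μ α : ℕ → ℕ} {A : ℕ → ℕ → ℕ} (h : IsHChain n μ α A)
    (k i : ℕ) : A k (i + 1) ≤ A k i :=
  (h.mono k _).trans (h.strip k i)

theorem IsHChain.isShapeChain {n : ℕ} {μ α : ℕ → ℕ} {A : ℕ → ℕ → ℕ} (h : IsHChain n μ α A) :
    IsShapeChain n μ α A :=
  ⟨h.init, h.final, h.mono, h.antitone⟩

theorem IsHChain.le_final {n : ℕ} {μ α : ℕ → ℕ} {A : ℕ → ℕ → ℕ} (h : IsHChain n μ α A)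
    (k i : ℕ) : A k i ≤ α i :=
  h.isShapeChain.le_final k i

/-- The finite set of chains of `n` horizontal strips from `μ` to `α`. -/
def hChains (n : ℕ) (μ α : ℕ → ℕ) : Finset (ℕ → ℕ → ℕ) :=
  {A ∈ shapeChains n μ α | ∀ k i, A (k + 1) (i + 1) ≤ A k i}

theorem mem_hChains {n : ℕ} {μ α : ℕ → ℕ} (hα : ∀ i, n ≤ i → α i = 0) {A : ℕ → ℕ → ℕ} :
    A ∈ hChains n μ α ↔ IsHChain n μ α A := by
  rw [hChains, Finset.mem_filter, mem_shapeChains hα]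
  exact ⟨fun h => ⟨h.1.init, h.1.final, h.1.mono, h.2⟩, fun h => ⟨h.isShapeChain, h.strip⟩⟩

/-- The number of letters `k` in the first `i` rows of the chain. -/
def letterCount (A : ℕ → ℕ → ℕ) (k i : ℕ) : ℤ :=
  ∑ p ∈ Finset.range i, ((A (k + 1) p : ℤ) - A k p)

/-- The number of letters `k` in the first `n` rows of the chain. -/
def chainCont (n : ℕ) (A : ℕ → ℕ → ℕ) (k : ℕ) : ℕ :=
  ∑ p ∈ Finset.range n, (A (k + 1) p - A k p)

/-- The lattice condition. -/
def IsLattice (A : ℕ → ℕ → ℕ) : Prop :=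
  ∀ k i, letterCount A (k + 1) (i + 1) ≤ letterCount A k i

theorem letterCount_succ (A : ℕ → ℕ → ℕ) (k i : ℕ) :
    letterCount A k (i + 1) = letterCount A k i + ((A (k + 1) i : ℤ) - A k i) :=
  Finset.sum_range_succ _ _

theorem letterCount_zero (A : ℕ → ℕ → ℕ) (k : ℕ) : letterCount A k 0 = 0 := rfl

theorem IsHChain.chainCont_eq {n : ℕ} {μ α : ℕ → ℕ} {A : ℕ → ℕ → ℕ} (h : IsHChain n μ α A)
    (m k : ℕ) : (chainCont m A k : ℤ) = letterCount A k m := by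
  unfold chainCont letterCount
  push_cast
  exact Finset.sum_congr rfl fun p _ => by rw [Nat.cast_sub (h.mono k p)]

theorem IsHChain.letterCount_mono {n : ℕ} {μ α : ℕ → ℕ} {A : ℕ → ℕ → ℕ}
    (h : IsHChain n μ α A) (k i : ℕ) : letterCount A k i ≤ letterCount A k (i + 1) := by
  rw [letterCount_succ]
  have := h.mono k i
  omega

theorem IsHChain.letterCount_nonneg {n : ℕ} {μ α : ℕ → ℕ} {A : ℕ → ℕ → ℕ}
    (h : IsHChain n μ α A) (k i : ℕ) : 0 ≤ letterCount A k i := by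
  rw [← h.chainCont_eq]
  positivity

theorem IsHChain.letterCount_of_le {n : ℕ} {μ α : ℕ → ℕ} {A : ℕ → ℕ → ℕ}
    (h : IsHChain n μ α A) {k : ℕ} (hk : n ≤ k) (i : ℕ) : letterCount A k i = 0 := by
  refine Finset.sum_eq_zero fun p _ => ?_
  rw [h.final k p hk, h.final (k + 1) p (by omega), sub_self]

/-- `(k, i)` is the position of the first failure of the lattice condition: the row `i` is
minimal, and then the letter `k` is maximal. -/
structure IsFirstBad (A : ℕ → ℕ → ℕ) (x : ℕ × ℕ) : Prop where
  bad : letterCount A x.1 x.2 < letterCount A (x.1 + 1) (x.2 + 1)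
  row : ∀ k i, i < x.2 → letterCount A (k + 1) (i + 1) ≤ letterCount A k i
  letter : ∀ k, x.1 < k → letterCount A (k + 1) (x.2 + 1) ≤ letterCount A k x.2

theorem IsFirstBad.unique {A : ℕ → ℕ → ℕ} {x y : ℕ × ℕ} (hx : IsFirstBad A x)
    (hy : IsFirstBad A y) : x = y := by
  have h1 : x.2 = y.2 := by
    rcases lt_trichotomy x.2 y.2 with h | h | h
    · exact absurd (hy.row _ _ h) (not_le.2 hx.bad)
    · exact h
    · exact absurd (hx.row _ _ h) (not_le.2 hy.bad)
  refine Prod.ext ?_ h1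
  rcases lt_trichotomy x.1 y.1 with h | h | h
  · exact absurd (hx.letter _ h) (by rw [h1]; exact not_le.2 hy.bad)
  · exact h
  · exact absurd (hy.letter _ h) (by rw [← h1]; exact not_le.2 hx.bad)

theorem IsHChain.letter_lt {n : ℕ} {μ α : ℕ → ℕ} {A : ℕ → ℕ → ℕ} (h : IsHChain n μ α A)
    {k i : ℕ} (hb : letterCount A k i < letterCount A (k + 1) (i + 1)) : k + 1 < n := by
  by_contra hcon
  rw [h.letterCount_of_le (k := k + 1) (by omega)] at hb
  exact absurd (h.letterCount_nonneg k i) (not_le.2 hb)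

theorem IsHChain.exists_isFirstBad {n : ℕ} {μ α : ℕ → ℕ} {A : ℕ → ℕ → ℕ}
    (h : IsHChain n μ α A) (hA : ¬IsLattice A) : ∃ x, IsFirstBad A x := by
  have hex : ∃ i k, letterCount A k i < letterCount A (k + 1) (i + 1) := by
    unfold IsLattice at hA
    push Not at hA
    exact ⟨_, _, hA.choose_spec.choose_spec⟩
  have hk := Nat.find_spec hex
  set i := Nat.find hex with hi
  have hmin : ∀ k i', i' < i → letterCount A (k + 1) (i' + 1) ≤ letterCount A k i' := by
    intro k i' hi'
    have := Nat.find_min hex hi'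
    push Not at this
    exact this k
  obtain ⟨k, hk⟩ := hk
  refine ⟨(Nat.findGreatest (fun k => letterCount A k i < letterCount A (k + 1) (i + 1)) n, i),
    ?_, hmin, ?_⟩
  · exact Nat.findGreatest_spec (P := fun k => letterCount A k i < letterCount A (k + 1) (i + 1))
      (by have := h.letter_lt hk; omega) hk
  · intro k' hk'
    by_contra hcon
    push Not at hcon
    have := h.letter_lt hcon
    exact Nat.findGreatest_is_greatest hk' (by omega) hcon

/-- The number of letters in the row of the first failure that remain untouched. -/
def excess (A : ℕ → ℕ → ℕ) (k i : ℕ) : ℕ :=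
  (letterCount A k i + 1 - letterCount A (k + 1) i).toNat

/-- The Bender–Knuth type involution applied after the first failure. -/
def toggle (A : ℕ → ℕ → ℕ) (x : ℕ × ℕ) : ℕ → ℕ → ℕ :=
  Function.update A (x.1 + 1) fun i =>
    if i < x.2 then A (x.1 + 1) i
    else if i = x.2 then
      max (A x.1 i) (A (x.1 + 2) (i + 1)) + (A (x.1 + 2) i - excess A x.1 x.2) - A (x.1 + 1) i
    else max (A x.1 i) (A (x.1 + 2) (i + 1)) + min (A (x.1 + 2) i) (A x.1 (i - 1)) -
      A (x.1 + 1) i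

theorem toggle_of_ne (A : ℕ → ℕ → ℕ) (x : ℕ × ℕ) {k : ℕ} (hk : k ≠ x.1 + 1) :
    toggle A x k = A k :=
  Function.update_of_ne hk _ _

theorem toggle_of_lt (A : ℕ → ℕ → ℕ) (x : ℕ × ℕ) {i : ℕ} (hi : i < x.2) :
    toggle A x (x.1 + 1) i = A (x.1 + 1) i := by
  simp [toggle, hi]

theorem toggle_self (A : ℕ → ℕ → ℕ) (x : ℕ × ℕ) :
    toggle A x (x.1 + 1) x.2 = max (A x.1 x.2) (A (x.1 + 2) (x.2 + 1)) +
      (A (x.1 + 2) x.2 - excess A x.1 x.2) - A (x.1 + 1) x.2 := by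
  simp [toggle]

theorem toggle_of_gt (A : ℕ → ℕ → ℕ) (x : ℕ × ℕ) {i : ℕ} (hi : x.2 ≤ i) :
    toggle A x (x.1 + 1) (i + 1) = max (A x.1 (i + 1)) (A (x.1 + 2) (i + 1 + 1)) +
      min (A (x.1 + 2) (i + 1)) (A x.1 i) - A (x.1 + 1) (i + 1) := by
  have h1 : ¬ i + 1 < x.2 := by omega
  have h2 : i + 1 ≠ x.2 := by omega
  simp [toggle, h1, h2]

theorem letterCount_toggle_of_ne (A : ℕ → ℕ → ℕ) (x : ℕ × ℕ) {k : ℕ} (h1 : k ≠ x.1)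
    (h2 : k ≠ x.1 + 1) (i : ℕ) : letterCount (toggle A x) k i = letterCount A k i := by
  unfold letterCount
  rw [toggle_of_ne A x h2, toggle_of_ne A x (by omega)]

theorem letterCount_toggle_of_le (A : ℕ → ℕ → ℕ) (x : ℕ × ℕ) (k : ℕ) {i : ℕ} (hi : i ≤ x.2) :
    letterCount (toggle A x) k i = letterCount A k i := by
  have key : ∀ k p, p < x.2 → toggle A x k p = A k p := by
    intro k p hp
    rcases eq_or_ne k (x.1 + 1) with rfl | hk
    · exact toggle_of_lt A x hp
    · rw [toggle_of_ne A x hk]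
  unfold letterCount
  refine Finset.sum_congr rfl fun p hp => ?_
  have hp' : p < x.2 := (Finset.mem_range.1 hp).trans_le hi
  rw [key _ _ hp', key _ _ hp']

section Involution

variable {n : ℕ} {μ α : ℕ → ℕ} {A : ℕ → ℕ → ℕ} {x : ℕ × ℕ}

theorem excess_spec (hA : IsHChain n μ α A) (hx : IsFirstBad A x) :
    (excess A x.1 x.2 : ℤ) = letterCount A x.1 x.2 + 1 - letterCount A (x.1 + 1) x.2 ∧
      1 ≤ excess A x.1 x.2 := by
  have h : 1 ≤ letterCount A x.1 x.2 + 1 - letterCount A (x.1 + 1) x.2 := by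
    rcases Nat.eq_zero_or_pos x.2 with h0 | h0
    · rw [h0, letterCount_zero, letterCount_zero]; omega
    · obtain ⟨j, hj⟩ := Nat.exists_eq_add_of_lt h0
      have h1 := hx.row x.1 j (by omega)
      have h2 := hA.letterCount_mono x.1 j
      rw [show x.2 = j + 1 by omega]
      omega
  unfold excess
  omega

theorem excess_le (hA : IsHChain n μ α A) (hx : IsFirstBad A x) :
    A (x.1 + 1) x.2 + excess A x.1 x.2 ≤ A (x.1 + 2) x.2 := by
  have h1 := (excess_spec hA hx).1
  have h2 := hx.bad
  rw [letterCount_succ] at h2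
  change _ < _ + ((A (x.1 + 2) x.2 : ℤ) - _) at h2
  omega

theorem le_add_excess (hA : IsHChain n μ α A) (hx : IsFirstBad A x) {j : ℕ}
    (hj : x.2 = j + 1) : A (x.1 + 2) x.2 ≤ A x.1 j + excess A x.1 x.2 := by
  have h1 := (excess_spec hA hx).1
  have h2 := hx.row x.1 j (by omega)
  have h3 := letterCount_succ A x.1 j
  have h4 := hA.strip (x.1 + 1) j
  rw [← hj] at h2 h3 h4
  change A (x.1 + 2) x.2 ≤ _ at h4
  omega

theorem isHChain_toggle (hA : IsHChain n μ α A) (hx : IsFirstBad A x) :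
    IsHChain n μ α (toggle A x) := by
  have hk := hA.letter_lt hx.bad
  have ht := excess_le hA hx
  have ht1 := (excess_spec hA hx).2
  have hlow : ∀ i, A x.1 i ≤ A (x.1 + 1) i := hA.mono x.1
  have hup : ∀ i, A (x.1 + 1) i ≤ A (x.1 + 2) i := hA.mono (x.1 + 1)
  have hs1 : ∀ i, A (x.1 + 1) (i + 1) ≤ A x.1 i := hA.strip x.1
  have hs2 : ∀ i, A (x.1 + 2) (i + 1) ≤ A (x.1 + 1) i := hA.strip (x.1 + 1)
  have bounds : ∀ i, A x.1 i ≤ toggle A x (x.1 + 1) i ∧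
      A (x.1 + 2) (i + 1) ≤ toggle A x (x.1 + 1) i ∧
      toggle A x (x.1 + 1) i ≤ A (x.1 + 2) i ∧
      ∀ j, i = j + 1 → toggle A x (x.1 + 1) i ≤ A x.1 j := by
    intro i
    rcases lt_trichotomy i x.2 with hi | rfl | hi
    · rw [toggle_of_lt A x hi]
      exact ⟨hlow i, hs2 i, hup i, fun j hj => hj ▸ hs1 j⟩
    · rw [toggle_self]
      have := hlow x.2
      have := hs2 x.2
      refine ⟨by omega, by omega, by omega, fun j hj => ?_⟩
      have := le_add_excess hA hx hj
      omega
    · obtain ⟨j, rfl⟩ : ∃ j, i = j + 1 := ⟨i - 1, by omega⟩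
      rw [toggle_of_gt A x (by omega)]
      have := hlow (j + 1)
      have := hs2 (j + 1)
      have := hup (j + 1)
      have := hs1 j
      refine ⟨by omega, by omega, by omega, fun j' hj => ?_⟩
      obtain rfl : j = j' := by omega
      omega
  refine ⟨?_, ?_, ?_, ?_⟩
  · intro i
    rw [toggle_of_ne A x (by omega)]
    exact hA.init i
  · intro k i hk'
    rw [toggle_of_ne A x (by omega)]
    exact hA.final k i hk'
  · intro k i
    rcases eq_or_ne k x.1 with rfl | h1
    · rw [toggle_of_ne A x (k := x.1) (by omega)]
      exact (bounds i).1
    rcases eq_or_ne k (x.1 + 1) with rfl | h2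
    · rw [toggle_of_ne A x (k := x.1 + 1 + 1) (by omega)]
      exact (bounds i).2.2.1
    · rw [toggle_of_ne A x h2, toggle_of_ne A x (by omega)]
      exact hA.mono k i
  · intro k i
    rcases eq_or_ne k x.1 with rfl | h1
    · rw [toggle_of_ne A x (k := x.1) (by omega)]
      exact (bounds (i + 1)).2.2.2 i rfl
    rcases eq_or_ne k (x.1 + 1) with rfl | h2
    · rw [toggle_of_ne A x (k := x.1 + 1 + 1) (by omega)]
      exact (bounds i).2.1
    · rw [toggle_of_ne A x h2, toggle_of_ne A x (by omega)]
      exact hA.strip k i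

theorem isFirstBad_toggle (hA : IsHChain n μ α A) (hx : IsFirstBad A x) :
    IsFirstBad (toggle A x) x := by
  refine ⟨?_, ?_, ?_⟩
  · rw [letterCount_toggle_of_le A x _ le_rfl, letterCount_succ,
      letterCount_toggle_of_le A x _ le_rfl, toggle_of_ne A x (k := x.1 + 1 + 1) (by omega),
      toggle_self]
    have h1 := (excess_spec hA hx).1
    have h2 := excess_le hA hx
    have h3 := hA.mono x.1 x.2
    have h4 : A (x.1 + 2) (x.2 + 1) ≤ _ := hA.strip (x.1 + 1) x.2
    change _ < _ + ((A (x.1 + 2) x.2 : ℤ) - _)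
    omega
  · intro k i hi
    rw [letterCount_toggle_of_le A x _ (by omega), letterCount_toggle_of_le A x _ (by omega)]
    exact hx.row k i hi
  · intro k hk
    rw [letterCount_toggle_of_le A x _ le_rfl,
      letterCount_toggle_of_ne A x (by omega) (by omega)]
    exact hx.letter k hk

theorem toggle_toggle (hA : IsHChain n μ α A) (hx : IsFirstBad A x) :
    toggle (toggle A x) x = A := by
  have hexc : excess (toggle A x) x.1 x.2 = excess A x.1 x.2 := by
    unfold excess
    rw [letterCount_toggle_of_le A x _ le_rfl, letterCount_toggle_of_le A x _ le_rfl]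
  have ht := excess_le hA hx
  have hlow : ∀ i, A x.1 i ≤ A (x.1 + 1) i := hA.mono x.1
  have hup : ∀ i, A (x.1 + 1) i ≤ A (x.1 + 2) i := hA.mono (x.1 + 1)
  have hs1 : ∀ i, A (x.1 + 1) (i + 1) ≤ A x.1 i := hA.strip x.1
  have hs2 : ∀ i, A (x.1 + 2) (i + 1) ≤ A (x.1 + 1) i := hA.strip (x.1 + 1)
  funext k i
  rcases eq_or_ne k (x.1 + 1) with rfl | hk
  · have e1 : toggle A x x.1 = A x.1 := toggle_of_ne A x (by omega)
    have e2 : toggle A x (x.1 + 2) = A (x.1 + 2) := toggle_of_ne A x (by omega)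
    rcases lt_trichotomy i x.2 with hi | rfl | hi
    · rw [toggle_of_lt _ x hi, toggle_of_lt _ x hi]
    · rw [toggle_self, hexc, e1, e2, toggle_self]
      have := hlow x.2
      have := hs2 x.2
      omega
    · obtain ⟨j, rfl⟩ : ∃ j, i = j + 1 := ⟨i - 1, by omega⟩
      rw [toggle_of_gt _ x (by omega), e1, e2, toggle_of_gt A x (by omega)]
      have := hlow (j + 1)
      have := hs2 (j + 1)
      have := hup (j + 1)
      have := hs1 j
      omega
  · rw [toggle_of_ne _ x hk, toggle_of_ne A x hk]

theorem letterCount_toggle (hA : IsHChain n μ α A) (hx : IsFirstBad A x) {i : ℕ}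
    (hi : x.2 ≤ i) : letterCount (toggle A x) x.1 (i + 1) =
      letterCount A (x.1 + 1) (i + 1) - 1 +
        ((max (A x.1 i) (A (x.1 + 2) (i + 1)) : ℕ) - (A x.1 i : ℤ)) := by
  have e1 : toggle A x x.1 = A x.1 := toggle_of_ne A x (by omega)
  have hlow : ∀ i, A x.1 i ≤ A (x.1 + 1) i := hA.mono x.1
  have hup : ∀ i, A (x.1 + 1) i ≤ A (x.1 + 2) i := hA.mono (x.1 + 1)
  have hs1 : ∀ i, A (x.1 + 1) (i + 1) ≤ A x.1 i := hA.strip x.1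
  have hs2 : ∀ i, A (x.1 + 2) (i + 1) ≤ A (x.1 + 1) i := hA.strip (x.1 + 1)
  have ht := excess_le hA hx
  have ht1 := (excess_spec hA hx).1
  induction i, hi using Nat.le_induction with
  | base =>
    rw [letterCount_succ, letterCount_succ, letterCount_toggle_of_le A x _ le_rfl, e1,
      toggle_self]
    have := hlow x.2
    have := hs2 x.2
    change _ = _ + ((A (x.1 + 2) x.2 : ℤ) - _) - 1 + _
    omega
  | succ i hi ih =>
    rw [letterCount_succ, ih, letterCount_succ _ _ (i + 1), e1, toggle_of_gt A x hi]
    have := hlow (i + 1)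
    have := hs2 (i + 1)
    have := hup (i + 1)
    have := hs1 i
    change _ = _ + ((A (x.1 + 2) (i + 1) : ℤ) - _) - 1 +
      ((max (A x.1 (i + 1)) (A (x.1 + 2) (i + 1 + 1)) : ℕ) - _)
    omega

theorem letterCount_toggle_add (A : ℕ → ℕ → ℕ) (x : ℕ × ℕ) (i : ℕ) :
    letterCount (toggle A x) x.1 i + letterCount (toggle A x) (x.1 + 1) i =
      letterCount A x.1 i + letterCount A (x.1 + 1) i := by
  unfold letterCount
  rw [← Finset.sum_add_distrib, ← Finset.sum_add_distrib,
    toggle_of_ne A x (k := x.1) (by omega), toggle_of_ne A x (k := x.1 + 1 + 1) (by omega)]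
  refine Finset.sum_congr rfl fun p _ => ?_
  ring

theorem IsHChain.row_lt (hα : ∀ i, n ≤ i → α i = 0) (hA : IsHChain n μ α A)
    (hx : IsFirstBad A x) : x.2 < n := by
  by_contra hcon
  have hk := hA.letter_lt hx.bad
  have hz : ∀ k, A k x.2 = 0 := by
    intro k
    have := hA.le_final k x.2
    rw [hα _ (by omega)] at this
    omega
  have hb := hx.bad
  rw [letterCount_succ, hz, hz] at hb
  have h1 := hx.row x.1 (x.2 - 1) (by omega)
  have h2 := hA.letterCount_mono x.1 (x.2 - 1)
  rw [show x.2 - 1 + 1 = x.2 by omega] at h1 h2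
  simp only [CharP.cast_eq_zero, sub_self, add_zero] at hb
  omega

/-- The shift of a vector by the staircase. -/
def shift (n : ℕ) (c : ℕ → ℕ) : Fin n → ℕ := fun i => c i + (n - 1 - i)

theorem shift_chainCont_toggle (hα : ∀ i, n ≤ i → α i = 0) (hA : IsHChain n μ α A)
    (hx : IsFirstBad A x) (hk : x.1 + 1 < n) :
    shift n (chainCont n (toggle A x)) = shift n (chainCont n A) ∘
      Equiv.swap (⟨x.1, by omega⟩ : Fin n) ⟨x.1 + 1, hk⟩ := by
  have hi := hA.row_lt hα hx
  have hT := isHChain_toggle hA hx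
  have h0 : ∀ k, A k n = 0 := fun k => by
    have := hA.le_final k n
    rw [hα n le_rfl] at this
    omega
  have h1 := letterCount_toggle hA hx (i := n - 1) (by omega)
  rw [show n - 1 + 1 = n by omega, h0] at h1
  have h2 := letterCount_toggle_add A x n
  simp only [← hA.chainCont_eq, ← hT.chainCont_eq] at h1 h2
  ext j
  simp only [shift, Function.comp]
  rcases eq_or_ne j ⟨x.1, by omega⟩ with rfl | hj
  · rw [Equiv.swap_apply_left]
    simp only
    omega
  rcases eq_or_ne j ⟨x.1 + 1, hk⟩ with rfl | hj'
  · rw [Equiv.swap_apply_right]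
    simp only
    omega
  · rw [Equiv.swap_apply_of_ne_of_ne hj hj']
    have hj1 : (j : ℕ) ≠ x.1 := fun h => hj (Fin.ext h)
    have hj2 : (j : ℕ) ≠ x.1 + 1 := fun h => hj' (Fin.ext h)
    have := letterCount_toggle_of_ne A x hj1 hj2 n
    rw [← hA.chainCont_eq, ← hT.chainCont_eq] at this
    omega

end Involution

/-- Cancellation of the non-lattice chains in an alternating sum. -/
theorem sum_hChains_eq_sum_isLattice {R : Type*} [CommRing R] {n : ℕ} {G : (Fin n → ℕ) → R}
    (hG : IsAlternating G) {μ α : ℕ → ℕ} (hα : ∀ i, n ≤ i → α i = 0) :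
    ∑ A ∈ hChains n μ α, G (shift n (chainCont n A)) =
      ∑ A ∈ hChains n μ α with IsLattice A, G (shift n (chainCont n A)) := by
  rw [← Finset.sum_filter_add_sum_filter_not (hChains n μ α) IsLattice, add_eq_left]
  have hch : ∀ A ∈ (hChains n μ α).filter (fun A => ¬IsLattice A), IsHChain n μ α A :=
    fun A hA => (mem_hChains hα).1 (Finset.mem_filter.1 hA).1
  have hex : ∀ A ∈ (hChains n μ α).filter (fun A => ¬IsLattice A), ∃ x, IsFirstBad A x :=
    fun A hA => (hch A hA).exists_isFirstBad (Finset.mem_filter.1 hA).2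
  refine Finset.sum_involution (fun A hA => toggle A (hex A hA).choose) ?_ ?_ ?_ ?_
  · intro A hA
    have hx := (hex A hA).choose_spec
    rw [shift_chainCont_toggle hα (hch A hA) hx ((hch A hA).letter_lt hx.bad),
      hG.swap _ _ _ (by simp)]
    simp
  · intro A hA h0 heq
    apply h0
    have hx := (hex A hA).choose_spec
    have hk := (hch A hA).letter_lt hx.bad
    have := shift_chainCont_toggle hα (hch A hA) hx hk
    rw [heq] at this
    refine hG.eq_zero _ ⟨(hex A hA).choose.1, by omega⟩ ⟨(hex A hA).choose.1 + 1, hk⟩ (by simp) ?_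
    have h2 := congrFun this ⟨(hex A hA).choose.1, by omega⟩
    simpa using h2
  · intro A hA
    have hx := (hex A hA).choose_spec
    rw [Finset.mem_filter, mem_hChains hα]
    refine ⟨isHChain_toggle (hch A hA) hx, fun hlat => ?_⟩
    exact absurd (hlat _ _) (not_le.2 (isFirstBad_toggle (hch A hA) hx).bad)
  · intro A hA
    have hx := (hex A hA).choose_spec
    have hx' := isFirstBad_toggle (hch A hA) hx
    generalize_proofs p1 p2
    have : p2.choose = p1.choose := p2.choose_spec.unique hx'
    rw [this]
    exact toggle_toggle (hch A hA) hx

/-! ### Partitions and the bijection between step sequences and chains -/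

/-- Partitions of `m` with at most `n` parts. -/
structure IsPar (n m : ℕ) (a : ℕ → ℕ) : Prop where
  anti : ∀ i, a (i + 1) ≤ a i
  zero : ∀ i, n ≤ i → a i = 0
  sum : ∑ i ∈ Finset.range n, a i = m

theorem finite_isPar (n m : ℕ) : {a | IsPar n m a}.Finite := by
  have hle : ∀ a, IsPar n m a → ∀ i : Fin n, a i < m + 1 := by
    intro a ha i
    rw [← ha.sum, Nat.lt_succ_iff]
    exact Finset.single_le_sum (f := a) (fun _ _ => Nat.zero_le _) (Finset.mem_range.2 i.2)
  let f : {a | IsPar n m a} → (Fin n → Fin (m + 1)) := fun a i => ⟨a.1 i, hle a.1 a.2 i⟩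
  have hf : Function.Injective f := by
    rintro ⟨a, ha⟩ ⟨b, hb⟩ hab
    ext i
    by_cases hi : n ≤ i
    · exact (IsPar.zero ha i hi).trans (IsPar.zero hb i hi).symm
    simpa [f] using congrFun hab ⟨i, by omega⟩
  exact Set.finite_coe_iff.1 (Finite.of_injective f hf)

/-- The finite set of partitions of `m` with at most `n` parts. -/
def parSet (n m : ℕ) : Finset (ℕ → ℕ) := (finite_isPar n m).toFinset

theorem mem_parSet {n m : ℕ} {a : ℕ → ℕ} : a ∈ parSet n m ↔ IsPar n m a := by
  simp [parSet]

theorem isPar_zero (n : ℕ) : IsPar n 0 (fun _ => 0) := ⟨by simp, by simp, by simp⟩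

/-- Step sequences of total size `m`. -/
def stepSet (n m : ℕ) : Finset (Fin n → Fin n → ℕ) :=
  (hSet n m).biUnion fun c => Fintype.piFinset fun k => hSet n (c k)

theorem mem_stepSet {n m : ℕ} {d : Fin n → Fin n → ℕ} :
    d ∈ stepSet n m ↔ ∑ k, ∑ i, d k i = m := by
  simp only [stepSet, Finset.mem_biUnion, Fintype.mem_piFinset, mem_hSet]
  constructor
  · rintro ⟨c, hc, hd⟩
    rw [← hc]
    exact Finset.sum_congr rfl fun k _ => hd k
  · intro h
    exact ⟨fun k => ∑ i, d k i, h, fun k => rfl⟩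

theorem sum_hSet_sum_piFinset {M : Type*} [AddCommMonoid M] {n m : ℕ}
    {S : ℕ → Finset (Fin n → ℕ)} (hS : ∀ c d, d ∈ S c → ∑ i, d i = c)
    (P : (Fin n → Fin n → ℕ) → Prop) (f : (Fin n → ℕ) → (Fin n → Fin n → ℕ) → M) :
    ∑ c ∈ hSet n m, ∑ d ∈ Fintype.piFinset (fun k => S (c k)) with P d, f c d =
      ∑ d ∈ stepSet n m with P d ∧ ∀ k, d k ∈ S (∑ i, d k i), f (fun k => ∑ i, d k i) d := by
  rw [Finset.sum_sigma']
  refine Finset.sum_nbij' (fun x => x.2) (fun d => ⟨fun k => ∑ i, d k i, d⟩) ?_ ?_ ?_ ?_ ?_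
  · rintro ⟨c, d⟩ h
    simp only [Finset.mem_sigma, Finset.mem_filter, Fintype.mem_piFinset, mem_hSet,
      mem_stepSet] at h ⊢
    refine ⟨?_, h.2.2, fun k => ?_⟩
    · rw [← h.1]
      exact Finset.sum_congr rfl fun k _ => hS _ _ (h.2.1 k)
    · rw [hS _ _ (h.2.1 k)]
      exact h.2.1 k
  · intro d h
    simp only [Finset.mem_sigma, Finset.mem_filter, Fintype.mem_piFinset, mem_hSet,
      mem_stepSet] at h ⊢
    exact ⟨h.1, h.2.2, h.2.1⟩
  · rintro ⟨c, d⟩ h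
    simp only [Finset.mem_sigma, Finset.mem_filter, Fintype.mem_piFinset] at h
    obtain rfl : (fun k => ∑ i, d k i) = c := funext fun k => hS _ _ (h.2.1 k)
    rfl
  · intro d _
    rfl
  · rintro ⟨c, d⟩ h
    simp only [Finset.mem_sigma, Finset.mem_filter, Fintype.mem_piFinset] at h
    obtain rfl : (fun k => ∑ i, d k i) = c := funext fun k => hS _ _ (h.2.1 k)
    rfl

/-- The steps of a chain. -/
def chainSteps (n : ℕ) (A : ℕ → ℕ → ℕ) : Fin n → Fin n → ℕ := fun k i => A (k + 1) i - A k i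

/-- The chain with given starting point and steps. -/
def chainOfSteps {n : ℕ} (μ : ℕ → ℕ) (d : Fin n → Fin n → ℕ) : ℕ → ℕ → ℕ :=
  fun k i => if h : i < n then μ i + partialSum d k ⟨i, h⟩ else 0

theorem shift_chainOfSteps {n : ℕ} (μ : ℕ → ℕ) (d : Fin n → Fin n → ℕ) (k : ℕ) :
    shift n (chainOfSteps μ d k) = shift n μ + partialSum d k := by
  ext i
  simp only [shift, chainOfSteps, i.2, dif_pos, Pi.add_apply, Fin.eta]
  omega

theorem IsShapeChain.add_partialSum {n : ℕ} {μ α : ℕ → ℕ} {A : ℕ → ℕ → ℕ}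
    (h : IsShapeChain n μ α A) (k : ℕ) (i : Fin n) :
    μ i + partialSum (chainSteps n A) k i = A k i := by
  induction k with
  | zero => simp [partialSum_zero, h.init]
  | succ k ih =>
    by_cases hk : k < n
    · have := partialSum_succ (chainSteps n A) ⟨k, hk⟩
      simp only at this
      rw [this, Pi.add_apply, ← add_assoc, ih]
      have := h.mono k i
      simp only [chainSteps]
      omega
    · rw [partialSum_of_le _ (by omega), ← partialSum_of_le (k := k) _ (by omega), ih,
        h.final k _ (by omega), h.final (k + 1) _ (by omega)]

theorem shift_add_partialSum {n : ℕ} {μ α : ℕ → ℕ} {A : ℕ → ℕ → ℕ}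
    (h : IsShapeChain n μ α A) (k : ℕ) :
    shift n μ + partialSum (chainSteps n A) k = shift n (A k) := by
  ext i
  have := h.add_partialSum k i
  simp only [shift, Pi.add_apply]
  omega

theorem chainSteps_chainOfSteps {n : ℕ} (μ : ℕ → ℕ) (d : Fin n → Fin n → ℕ) :
    chainSteps n (chainOfSteps μ d) = d := by
  ext k i
  simp only [chainSteps, chainOfSteps, i.2, dif_pos, partialSum_succ, Pi.add_apply, Fin.eta]
  omega

theorem isStrictDecr_shift {n : ℕ} {c : ℕ → ℕ} :
    IsStrictDecr (shift n c) ↔ ∀ i, i + 1 < n → c (i + 1) ≤ c i := by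
  constructor
  · intro h i hi
    have := h ⟨i, by omega⟩ ⟨i + 1, hi⟩ rfl
    simp only [shift] at this
    omega
  · intro h p q hpq
    have := h p (by omega)
    have := q.2
    simp only [shift, hpq]
    omega

theorem goodE_iff {n : ℕ} {l d : Fin n → ℕ} : GoodE l d ↔ IsStrictDecr (l + d) := Iff.rfl

theorem isShapeChain_chainOfSteps {n s : ℕ} {μ : ℕ → ℕ} (hμ : IsPar n s μ)
    {d : Fin n → Fin n → ℕ} (hd : AllGood GoodE (shift n μ) d) :
    IsShapeChain n μ (chainOfSteps μ d n) (chainOfSteps μ d) := by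
  have hfin : ∀ k, n ≤ k → chainOfSteps μ d k = chainOfSteps μ d n := by
    intro k hk
    unfold chainOfSteps
    rw [partialSum_of_le d hk, partialSum_of_le d le_rfl]
  have h0 : chainOfSteps μ d 0 = μ := by
    ext i
    by_cases hi : i < n
    · simp [chainOfSteps, hi, partialSum_zero]
    · simp [chainOfSteps, hi, hμ.zero i (by omega)]
  have hsd : ∀ k, IsStrictDecr (shift n (chainOfSteps μ d k)) := by
    intro k
    induction k with
    | zero => rw [h0, isStrictDecr_shift]; exact fun i _ => hμ.anti i
    | succ k ih =>
      by_cases hk : k < n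
      · have h1 := goodE_iff.1 (hd ⟨k, hk⟩)
        rwa [add_assoc, ← partialSum_succ, ← shift_chainOfSteps] at h1
      · rw [hfin (k + 1) (by omega), ← hfin k (by omega)]
        exact ih
  refine ⟨fun i => congrFun h0 i, fun k i hk => by rw [hfin k hk], fun k i => ?_, fun k i => ?_⟩
  · by_cases hk : k < n
    · by_cases hi : i < n
      · have := congrFun (partialSum_succ d ⟨k, hk⟩) ⟨i, hi⟩
        simp only [Pi.add_apply] at this
        simp only [chainOfSteps, hi, dif_pos, this]
        omega
      · simp [chainOfSteps, hi]
    · rw [hfin (k + 1) (by omega), ← hfin k (by omega)]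
  · by_cases hi : i + 1 < n
    · exact isStrictDecr_shift.1 (hsd k) i hi
    · simp [chainOfSteps, hi]

theorem sum_allGood_eq_sum_shapeChains {M : Type*} [AddCommMonoid M] {n s m : ℕ} {μ : ℕ → ℕ}
    (hμ : IsPar n s μ) (f : (Fin n → Fin n → ℕ) → M) :
    ∑ d ∈ stepSet n m with AllGood GoodE (shift n μ) d, f d =
      ∑ α ∈ parSet n (s + m), ∑ A ∈ shapeChains n μ α, f (chainSteps n A) := by
  symm
  rw [Finset.sum_sigma']
  have htot : ∀ d : Fin n → Fin n → ℕ, ∑ i ∈ Finset.range n, chainOfSteps μ d n i =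
      s + ∑ k, ∑ i, d k i := by
    intro d
    rw [← hμ.sum, Finset.sum_comm, Finset.sum_range, Finset.sum_range, ← Finset.sum_add_distrib]
    refine Finset.sum_congr rfl fun i _ => ?_
    simp [chainOfSteps, partialSum_of_le d le_rfl]
  have hback : ∀ α, (∀ i, n ≤ i → α i = 0) → ∀ A, IsShapeChain n μ α A →
      chainOfSteps μ (chainSteps n A) = A := by
    intro α hα A hA
    ext k i
    by_cases hi : i < n
    · simp only [chainOfSteps, hi, dif_pos]
      exact hA.add_partialSum k ⟨i, hi⟩
    · have := hA.le_final k i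
      rw [hα i (by omega)] at this
      simp only [chainOfSteps, hi, dif_neg, not_false_eq_true]
      omega
  refine Finset.sum_bij' (fun x _ => chainSteps n x.2)
    (fun d _ => ⟨chainOfSteps μ d n, chainOfSteps μ d⟩) ?_ ?_ ?_ ?_ ?_
  · rintro ⟨α, A⟩ h
    simp only [Finset.mem_sigma, mem_parSet] at h
    have hα := h.1
    have hA := (mem_shapeChains hα.zero).1 h.2
    rw [Finset.mem_filter, mem_stepSet]
    constructor
    · have h1 := htot (chainSteps n A)
      rw [hback α hα.zero A hA, Finset.sum_congr rfl fun i _ => hA.final n i le_rfl, hα.sum] at h1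
      exact (Nat.add_left_cancel h1).symm
    · intro k
      rw [goodE_iff, add_assoc, ← partialSum_succ, shift_add_partialSum hA, isStrictDecr_shift]
      exact fun i _ => hA.anti _ i
  · intro d h
    rw [Finset.mem_filter, mem_stepSet] at h
    have hA := isShapeChain_chainOfSteps hμ h.2
    have hz : ∀ i, n ≤ i → chainOfSteps μ d n i = 0 := fun i hi => by
      simp [chainOfSteps, not_lt.2 hi]
    rw [Finset.mem_sigma, mem_parSet, mem_shapeChains hz]
    exact ⟨⟨hA.anti n, hz, by rw [htot, h.1]⟩, hA⟩
  · rintro ⟨α, A⟩ h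
    simp only [Finset.mem_sigma, mem_parSet] at h
    have hA := (mem_shapeChains h.1.zero).1 h.2
    have h1 := hback α h.1.zero A hA
    rw [Sigma.mk.injEq]
    simp only [h1, heq_eq_eq, and_true]
    exact funext fun i => hA.final n i le_rfl
  · intro d _
    exact chainSteps_chainOfSteps μ d
  · rintro ⟨α, A⟩ _
    rfl

/-! ### The alternating coefficient and products of alternants -/

/-- The coefficient of `l` in the formal alternant with exponents `shift n b`. -/
def altCoeff (R : Type*) [CommRing R] (n : ℕ) (b : ℕ → ℕ) (l : Fin n → ℕ) : R :=
  ∑ σ : Perm (Fin n), if l = shift n b ∘ σ then ((Perm.sign σ : ℤ) : R) else 0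

theorem strictAnti_shift {n : ℕ} {b : ℕ → ℕ} (hb : ∀ i, b (i + 1) ≤ b i) :
    StrictAnti (shift n b) := by
  intro i j hij
  have h1 : b j ≤ b i := antitone_nat_of_succ_le hb (by exact_mod_cast hij.le)
  have h2 : (i : ℕ) < j := hij
  have := j.2
  simp only [shift]
  omega

theorem isAlternating_altCoeff (R : Type*) [CommRing R] {n : ℕ} {b : ℕ → ℕ}
    (hb : ∀ i, b (i + 1) ≤ b i) : IsAlternating (altCoeff R n b) where
  swap l i j hij := by
    unfold altCoeff
    rw [← Finset.sum_neg_distrib, ← Equiv.sum_comp (Equiv.mulRight (Equiv.swap i j))]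
    refine Finset.sum_congr rfl fun σ _ => ?_
    have h1 : l ∘ Equiv.swap i j = shift n b ∘ (σ * Equiv.swap i j : Perm (Fin n)) ↔
        l = shift n b ∘ σ := by
      rw [Equiv.Perm.coe_mul, ← Function.comp_assoc]
      exact (Equiv.swap i j).surjective.right_cancellable
    simp only [Equiv.coe_mulRight, h1, Perm.sign_mul, Perm.sign_swap hij]
    split_ifs <;> simp
  eq_zero l i j hij h := by
    refine Finset.sum_eq_zero fun σ _ => if_neg ?_
    rintro rfl
    exact hij (σ.injective ((strictAnti_shift hb).injective h))

theorem altCoeff_shift (R : Type*) [CommRing R] {n : ℕ} {b c : ℕ → ℕ}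
    (hb : ∀ i, b (i + 1) ≤ b i) (hc : ∀ i, c (i + 1) ≤ c i) :
    altCoeff R n b (shift n c) = if ∀ i < n, c i = b i then 1 else 0 := by
  have key : ∀ σ : Perm (Fin n), shift n c = shift n b ∘ σ ↔ σ = 1 ∧ ∀ i < n, c i = b i := by
    intro σ
    constructor
    · intro h
      have hσ : StrictMono σ := by
        intro i j hij
        have := strictAnti_shift (n := n) hc hij
        rw [h] at this
        exact (strictAnti_shift hb).lt_iff_gt.1 this
      have h1 : σ = 1 := by
        have := Subsingleton.elim
          (hσ.orderIsoOfSurjective σ σ.surjective) (OrderIso.refl (Fin n))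
        ext i
        exact congrArg Fin.val (congrFun (congrArg (fun e : Fin n ≃o Fin n => ⇑e) this) i)
      subst h1
      refine ⟨rfl, fun i hi => ?_⟩
      have := congrFun h ⟨i, hi⟩
      simpa [shift] using this
    · rintro ⟨rfl, h⟩
      ext i
      simp [shift, h i i.2]
  unfold altCoeff
  simp only [key]
  split_ifs with h
  · rw [Finset.sum_eq_single 1]
    · rw [if_pos ⟨rfl, h⟩]
      simp
    · intro σ _ hσ
      simp [hσ]
    · simp
  · simp [h]

/-- The Jacobi–Trudi expression of the Schur polynomial of `b` in the variables `v`. -/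
def jacobiTrudi {R : Type*} [CommRing R] {n : ℕ} (m : ℕ) (b : ℕ → ℕ) (v : Fin n → R) : R :=
  ∑ c ∈ hSet n m, altCoeff R n b (fun i => c i + (n - 1 - i)) * ∏ k, monoSum v (hSet n (c k))

/-- The number of lattice chains from `μ` to `α` with content `b`. -/
def lrCoeff (n : ℕ) (μ α b : ℕ → ℕ) : ℕ :=
  #{A ∈ hChains n μ α | IsLattice A ∧ chainCont n A = b}

theorem sum_chainSteps (n : ℕ) (A : ℕ → ℕ → ℕ) (k : Fin n) :
    ∑ i, chainSteps n A k i = chainCont n A k := by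
  rw [chainCont, Finset.sum_range]
  rfl

theorem IsHChain.eq_zero {n : ℕ} {μ α : ℕ → ℕ} {A : ℕ → ℕ → ℕ} (hA : IsHChain n μ α A)
    (hα : ∀ i, n ≤ i → α i = 0) (k : ℕ) {i : ℕ} (hi : n ≤ i) : A k i = 0 := by
  have := hA.le_final k i
  rw [hα i hi] at this
  omega

theorem IsHChain.chainCont_anti {n : ℕ} {μ α : ℕ → ℕ} {A : ℕ → ℕ → ℕ} (hA : IsHChain n μ α A)
    (hα : ∀ i, n ≤ i → α i = 0) (hl : IsLattice A) (k : ℕ) :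
    chainCont n A (k + 1) ≤ chainCont n A k := by
  have h1 := hl k n
  have h2 := hA.chainCont_eq n k
  have h3 := hA.chainCont_eq n (k + 1)
  rw [letterCount_succ, hA.eq_zero hα _ le_rfl, hA.eq_zero hα _ le_rfl] at h1
  simp only [CharP.cast_eq_zero, sub_self, add_zero] at h1
  omega

theorem IsHChain.chainCont_of_le {n : ℕ} {μ α : ℕ → ℕ} {A : ℕ → ℕ → ℕ}
    (hA : IsHChain n μ α A) {k : ℕ} (hk : n ≤ k) : chainCont n A k = 0 := by
  have := hA.chainCont_eq n k
  rw [hA.letterCount_of_le hk] at this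
  omega

theorem goodH_shift_iff {n : ℕ} {μ α : ℕ → ℕ} {A : ℕ → ℕ → ℕ} (hA : IsShapeChain n μ α A)
    (hα : ∀ i, n ≤ i → α i = 0) :
    AllGood GoodH (shift n μ) (chainSteps n A) ↔ ∀ k i, A (k + 1) (i + 1) ≤ A k i := by
  have h0 : ∀ k i, n ≤ i → A k i = 0 := fun k i hi => by
    have := hA.le_final k i
    rw [hα i hi] at this
    omega
  unfold AllGood
  simp only [shift_add_partialSum hA, GoodH]
  constructor
  · intro h k i
    by_cases hk : k < n
    · by_cases hi : i + 1 < n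
      · have := h ⟨k, hk⟩ ⟨i, by omega⟩ ⟨i + 1, hi⟩ rfl
        have := hA.mono k (i + 1)
        simp only [shift, chainSteps] at *
        omega
      · rw [h0 _ _ (by omega)]
        exact Nat.zero_le _
    · rw [hA.final (k + 1) _ (by omega), ← hA.final k _ (by omega)]
      exact hA.anti k i
  · intro h k p q hpq
    have h1 := h k p
    have h2 := hA.mono k q
    have h3 := q.2
    rw [← hpq] at h1
    simp only [shift, chainSteps]
    omega

theorem AllGood.mono {n m : ℕ} {l : Fin n → ℕ} {d : Fin m → Fin n → ℕ}
    {good good' : (Fin n → ℕ) → (Fin n → ℕ) → Prop} (hg : ∀ l d, good l d → good' l d)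
    (h : AllGood good l d) : AllGood good' l d :=
  fun k => hg _ _ (h k)

theorem alternant_mul_jacobiTrudi {R : Type*} [CommRing R] {n s m : ℕ} {μ b : ℕ → ℕ}
    (hμ : IsPar n s μ) (hb : IsPar n m b) (v : Fin n → R) :
    alternant v (shift n μ) * jacobiTrudi m b v =
      ∑ α ∈ parSet n (s + m), (lrCoeff n μ α b : R) * alternant v (shift n α) := by
  have hμs : IsStrictDecr (shift n μ) := isStrictDecr_shift.2 fun i _ => hμ.anti i
  unfold jacobiTrudi
  have h1 : ∀ c : Fin n → ℕ, alternant v (shift n μ) *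
      (altCoeff R n b (fun i => c i + (n - 1 - i)) * ∏ k, monoSum v (hSet n (c k))) =
      ∑ d ∈ Fintype.piFinset (fun k => hSet n (c k)) with AllGood GoodH (shift n μ) d,
        altCoeff R n b (fun i => c i + (n - 1 - i)) * alternant v (shift n μ + ∑ k, d k) := by
    intro c
    rw [mul_left_comm, alternant_mul_prod_monoSum v _ fun k => isSymmSet_hSet n (c k),
      sum_piFinset_hSet (isAlternating_alternant v) c hμs, Finset.mul_sum]
  rw [Finset.mul_sum, Finset.sum_congr rfl fun c _ => h1 c,
    sum_hSet_sum_piFinset (S := hSet n) (fun c d h => mem_hSet.1 h)]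
  have h2 : (stepSet n m).filter (fun d => AllGood GoodH (shift n μ) d ∧
      ∀ k, d k ∈ hSet n (∑ i, d k i)) = ((stepSet n m).filter
        (fun d => AllGood GoodE (shift n μ) d)).filter (fun d => AllGood GoodH (shift n μ) d) := by
    ext d
    simp only [Finset.mem_filter, mem_hSet, and_assoc, implies_true, and_true]
    refine and_congr_right fun _ => ⟨fun h => ⟨h.mono fun l d hh p q hpq => ?_, h⟩, fun h => h.2⟩
    exact (hh p q hpq).trans_le (Nat.le_add_right _ _)
  rw [h2, Finset.sum_filter, sum_allGood_eq_sum_shapeChains hμ]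
  refine Finset.sum_congr rfl fun α hα => ?_
  rw [mem_parSet] at hα
  have h3 : ∑ A ∈ shapeChains n μ α, (if AllGood GoodH (shift n μ) (chainSteps n A) then
      altCoeff R n b (fun i => ∑ j, chainSteps n A i j + (n - 1 - i)) *
        alternant v (shift n μ + ∑ k, chainSteps n A k) else 0) =
      ∑ A ∈ hChains n μ α, alternant v (shift n α) * altCoeff R n b (shift n (chainCont n A)) := by
    rw [hChains, Finset.sum_filter]
    refine Finset.sum_congr rfl fun A hA => ?_
    rw [mem_shapeChains hα.zero] at hA
    simp only [goodH_shift_iff hA hα.zero]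
    refine if_congr Iff.rfl ?_ rfl
    rw [mul_comm, ← partialSum_of_le _ le_rfl, shift_add_partialSum hA,
      show A n = α from funext fun i => hA.final n i le_rfl]
    simp only [sum_chainSteps]
    rfl
  rw [h3, sum_hChains_eq_sum_isLattice ((isAlternating_altCoeff R hb.anti).const_mul _) hα.zero,
    ← Finset.mul_sum, mul_comm]
  congr 1
  rw [lrCoeff, ← Finset.filter_filter, Finset.card_filter, Nat.cast_sum]
  refine Finset.sum_congr rfl fun A hA => ?_
  rw [Finset.mem_filter, mem_hChains hα.zero] at hA
  rw [altCoeff_shift R hb.anti (hA.1.chainCont_anti hα.zero hA.2)]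
  have : (∀ i < n, chainCont n A i = b i) ↔ chainCont n A = b := by
    refine ⟨fun h => funext fun i => ?_, fun h i _ => congrFun h i⟩
    by_cases hi : i < n
    · exact h i hi
    · rw [hA.1.chainCont_of_le (by omega), hb.zero i (by omega)]
  simp only [this]
  split_ifs <;> simp

/-! ### Lattice chains starting at the empty partition -/

/-- The unique lattice chain from the empty partition. -/
def rowChain (α : ℕ → ℕ) : ℕ → ℕ → ℕ := fun k i => if i < k then α i else 0

theorem isHChain_rowChain {n m : ℕ} {α : ℕ → ℕ} (hα : IsPar n m α) :
    IsHChain n (fun _ => 0) α (rowChain α) := by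
  refine ⟨fun i => rfl, fun k i hk => ?_, fun k i => ?_, fun k i => ?_⟩
  · unfold rowChain
    split_ifs with h
    · rfl
    · exact (hα.zero i (by omega)).symm
  · unfold rowChain
    split_ifs <;> omega
  · have := hα.anti i
    unfold rowChain
    split_ifs <;> omega

theorem letterCount_rowChain (α : ℕ → ℕ) (k i : ℕ) :
    letterCount (rowChain α) k i = if k < i then (α k : ℤ) else 0 := by
  induction i with
  | zero => simp [letterCount_zero]
  | succ i ih =>
    rw [letterCount_succ, ih]
    unfold rowChain
    rcases lt_trichotomy k i with h | rfl | h
    · simp [h, h.trans (Nat.lt_succ_self i), Nat.not_lt.2 h.le,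
        Nat.not_lt.2 (Nat.succ_le_of_lt h)]
    · simp
    · simp [h, h.trans (Nat.lt_succ_self k), Nat.not_lt.2 h.le,
        Nat.not_lt.2 (Nat.succ_le_of_lt h)]

theorem isLattice_rowChain {n m : ℕ} {α : ℕ → ℕ} (hα : IsPar n m α) : IsLattice (rowChain α) := by
  intro k i
  rw [letterCount_rowChain, letterCount_rowChain]
  have := hα.anti k
  split_ifs <;> omega

theorem chainCont_rowChain {n m : ℕ} {α : ℕ → ℕ} (hα : IsPar n m α) :
    chainCont n (rowChain α) = α := by
  ext k
  have := (isHChain_rowChain hα).chainCont_eq n k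
  rw [letterCount_rowChain] at this
  split_ifs at this with h
  · omega
  · rw [hα.zero k (by omega)]
    omega

theorem IsHChain.eq_rowChain {n : ℕ} {α : ℕ → ℕ} {A : ℕ → ℕ → ℕ}
    (hA : IsHChain n (fun _ => 0) α A) (hl : IsLattice A) : A = rowChain α := by
  have h1 : ∀ k i, k ≤ i → A k i = 0 := by
    intro k
    induction k with
    | zero => exact fun i _ => hA.init i
    | succ k ih =>
      intro i hi
      obtain ⟨j, rfl⟩ : ∃ j, i = j + 1 := ⟨i - 1, by omega⟩
      have := hA.strip k j
      rw [ih j (by omega)] at this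
      omega
  have h2 : ∀ i k, i ≤ k → letterCount A k i = 0 := by
    intro i
    induction i with
    | zero => exact fun k _ => rfl
    | succ i ih =>
      intro k hk
      obtain ⟨j, rfl⟩ : ∃ j, k = j + 1 := ⟨k - 1, by omega⟩
      have := hl j i
      rw [ih j (by omega)] at this
      exact le_antisymm this (hA.letterCount_nonneg _ _)
  have h3 : ∀ k i, i < k → A (k + 1) i = A k i := by
    intro k i hi
    have := letterCount_succ A k i
    rw [h2 (i + 1) k hi, h2 i k hi.le] at this
    omega
  ext k i
  unfold rowChain
  split_ifs with h
  · have h4 : ∀ p, A (k + p) i = A k i := by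
      intro p
      induction p with
      | zero => rfl
      | succ p ih => rw [← ih, ← add_assoc, h3 _ _ (by omega)]
    rw [← h4 n, hA.final _ _ (by omega)]
  · exact h1 k i (by omega)

theorem filter_isLattice_hChains_zero {n m : ℕ} {α : ℕ → ℕ} (hα : IsPar n m α) :
    {A ∈ hChains n (fun _ => 0) α | IsLattice A} = {rowChain α} := by
  ext A
  rw [Finset.mem_filter, mem_hChains hα.zero, Finset.mem_singleton]
  constructor
  · exact fun h => h.1.eq_rowChain h.2
  · rintro rfl
    exact ⟨isHChain_rowChain hα, isLattice_rowChain hα⟩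

theorem lrCoeff_zero {n m : ℕ} {α : ℕ → ℕ} (hα : IsPar n m α) (b : ℕ → ℕ) :
    lrCoeff n (fun _ => 0) α b = if α = b then 1 else 0 := by
  rw [lrCoeff, ← Finset.filter_filter, filter_isLattice_hChains_zero hα, Finset.filter_singleton,
    chainCont_rowChain hα]
  split_ifs <;> simp

theorem sum_hChains_zero {R : Type*} [CommRing R] {n m : ℕ} {G : (Fin n → ℕ) → R}
    (hG : IsAlternating G) {α : ℕ → ℕ} (hα : IsPar n m α) :
    ∑ A ∈ hChains n (fun _ => 0) α, G (shift n (chainCont n A)) = G (shift n α) := by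
  rw [sum_hChains_eq_sum_isLattice hG hα.zero, filter_isLattice_hChains_zero hα,
    Finset.sum_singleton, chainCont_rowChain hα]

theorem alternant_zero_mul_jacobiTrudi {R : Type*} [CommRing R] {n m : ℕ} {b : ℕ → ℕ}
    (hb : IsPar n m b) (v : Fin n → R) :
    alternant v (shift n fun _ => 0) * jacobiTrudi m b v = alternant v (shift n b) := by
  rw [alternant_mul_jacobiTrudi (isPar_zero n) hb, zero_add]
  rw [Finset.sum_eq_single_of_mem b (mem_parSet.2 hb), lrCoeff_zero hb]
  · simp
  · intro α hα hne
    rw [lrCoeff_zero (mem_parSet.1 hα), if_neg hne]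
    simp

/-! ### Conjugation and the dual Cauchy identity -/

theorem lt_conjFun_iff {n : ℕ} {a : ℕ → ℕ} (ha : ∀ i, a (i + 1) ≤ a i) {i j : ℕ} :
    i < conjFun n a j ↔ i < n ∧ j < a i := by
  have hanti := antitone_nat_of_succ_le ha
  unfold conjFun
  constructor
  · intro h
    by_contra hcon
    refine absurd h (not_lt.2 ?_)
    conv_rhs => rw [← Finset.card_range i]
    refine Finset.card_le_card fun p hp => ?_
    rw [Finset.mem_filter, Finset.mem_range] at hp
    rw [Finset.mem_range]
    by_contra hip
    exact hcon ⟨by omega, hp.2.trans_le (hanti (not_lt.1 hip))⟩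
  · rintro ⟨hi, hj⟩
    rw [← Nat.succ_le_iff]
    conv_lhs => rw [← Nat.add_one, ← Finset.card_range (i + 1)]
    refine Finset.card_le_card fun p hp => ?_
    rw [Finset.mem_range] at hp
    rw [Finset.mem_filter, Finset.mem_range]
    exact ⟨by omega, hj.trans_le (hanti (by omega))⟩

theorem conjFun_mono {n : ℕ} {a b : ℕ → ℕ} (hab : ∀ i, a i ≤ b i) (j : ℕ) :
    conjFun n a j ≤ conjFun n b j :=
  Finset.card_le_card <| Finset.monotone_filter_right _ fun i _ h => lt_of_lt_of_le h (hab i)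

theorem conjFun_anti (n : ℕ) (a : ℕ → ℕ) (j : ℕ) : conjFun n a (j + 1) ≤ conjFun n a j :=
  Finset.card_le_card <| Finset.monotone_filter_right _ fun _ _ h => (Nat.lt_succ_self j).trans h

theorem conjFun_of_le {n : ℕ} {a : ℕ → ℕ} (ha : ∀ i, a i ≤ n) {j : ℕ} (hj : n ≤ j) :
    conjFun n a j = 0 := by
  refine Finset.card_eq_zero.2 (Finset.filter_eq_empty_iff.2 fun i _ => ?_)
  have := ha i
  omega

theorem conjFun_conjFun {n : ℕ} {a : ℕ → ℕ} (ha : ∀ i, a (i + 1) ≤ a i)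
    (hz : ∀ i, n ≤ i → a i = 0) (hn : ∀ i, a i ≤ n) : conjFun n (conjFun n a) = a := by
  ext i
  refine eq_of_forall_lt_iff fun j => ?_
  rw [lt_conjFun_iff (conjFun_anti n a), lt_conjFun_iff ha]
  constructor
  · exact fun h => h.2.2
  · intro h
    refine ⟨h.trans_le (hn i), ?_, h⟩
    by_contra hi
    rw [hz i (by omega)] at h
    omega

theorem sum_conjFun {n : ℕ} {a : ℕ → ℕ} (hn : ∀ i, a i ≤ n) :
    ∑ j ∈ Finset.range n, conjFun n a j = ∑ i ∈ Finset.range n, a i := by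
  simp only [conjFun, Finset.card_filter]
  rw [Finset.sum_comm]
  refine Finset.sum_congr rfl fun i _ => ?_
  rw [← Finset.card_filter]
  conv_rhs => rw [← Finset.card_range (a i)]
  congr 1
  ext j
  have := hn i
  simp only [Finset.mem_filter, Finset.mem_range]
  omega

theorem IsPar.le {n m : ℕ} {a : ℕ → ℕ} (ha : IsPar n m a) (i : ℕ) : a i ≤ m := by
  by_cases hi : i < n
  · rw [← ha.sum]
    exact Finset.single_le_sum (f := a) (fun _ _ => Nat.zero_le _) (Finset.mem_range.2 hi)
  · rw [ha.zero i (by omega)]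
    exact Nat.zero_le m

theorem IsPar.conj {n m : ℕ} {a : ℕ → ℕ} (ha : IsPar n m a) (hm : m ≤ n) :
    IsPar n m (conjFun n a) :=
  ⟨conjFun_anti n a, fun _ hi => conjFun_of_le (fun i => (ha.le i).trans hm) hi,
    (sum_conjFun fun i => (ha.le i).trans hm).trans ha.sum⟩

theorem IsPar.conj_conj {n m : ℕ} {a : ℕ → ℕ} (ha : IsPar n m a) (hm : m ≤ n) :
    conjFun n (conjFun n a) = a :=
  conjFun_conjFun ha.anti ha.zero fun i => (ha.le i).trans hm

/-- The finite set of chains of `n` vertical strips. -/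
def vChains (n : ℕ) (μ α : ℕ → ℕ) : Finset (ℕ → ℕ → ℕ) :=
  {A ∈ shapeChains n μ α | ∀ k i, A (k + 1) i ≤ A k i + 1}

theorem IsShapeChain.chainCont_eq {n : ℕ} {μ α : ℕ → ℕ} {A : ℕ → ℕ → ℕ}
    (hA : IsShapeChain n μ α A) (k : ℕ) : (chainCont n A k : ℤ) =
      ((∑ i ∈ Finset.range n, A (k + 1) i : ℕ) : ℤ) - (∑ i ∈ Finset.range n, A k i : ℕ) := by
  unfold chainCont
  push_cast
  rw [← Finset.sum_sub_distrib]
  exact Finset.sum_congr rfl fun p _ => by rw [Nat.cast_sub (hA.mono k p)]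

theorem IsShapeChain.conj {n : ℕ} {α : ℕ → ℕ} {A : ℕ → ℕ → ℕ}
    (hA : IsShapeChain n (fun _ => 0) α A) :
    IsShapeChain n (fun _ => 0) (conjFun n α) (fun k => conjFun n (A k)) := by
  refine ⟨fun i => ?_, fun k i hk => ?_, fun k => conjFun_mono (hA.mono k),
    fun k => conjFun_anti n _⟩
  · refine Finset.card_eq_zero.2 (Finset.filter_eq_empty_iff.2 fun i _ => ?_)
    rw [hA.init]
    omega
  · rw [show A k = α from funext fun i => hA.final k i hk]

theorem chainCont_conjFun {n m : ℕ} {α : ℕ → ℕ} {A : ℕ → ℕ → ℕ} (hα : IsPar n m α)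
    (hm : m ≤ n) (hA : IsShapeChain n (fun _ => 0) α A) :
    chainCont n (fun k => conjFun n (A k)) = chainCont n A := by
  ext k
  have h : ∀ k i, A k i ≤ n := fun k i => (hA.le_final k i).trans ((hα.le i).trans hm)
  have h1 := (hA.conj).chainCont_eq k
  have h2 := hA.chainCont_eq k
  rw [sum_conjFun (h k), sum_conjFun (h _)] at h1
  omega

theorem sum_vChains_zero {R : Type*} [CommRing R] {n m : ℕ} {G : (Fin n → ℕ) → R}
    (hG : IsAlternating G) {α : ℕ → ℕ} (hα : IsPar n m α) (hm : m ≤ n) :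
    ∑ A ∈ vChains n (fun _ => 0) α, G (shift n (chainCont n A)) =
      G (shift n (conjFun n α)) := by
  have hα' := hα.conj hm
  rw [← sum_hChains_zero hG hα']
  have hcc : ∀ (α : ℕ → ℕ) (A : ℕ → ℕ → ℕ), IsPar n m α → IsShapeChain n (fun _ => 0) α A →
      (fun k => conjFun n (conjFun n (A k))) = A := by
    intro α A hα hA
    funext k
    refine conjFun_conjFun (hA.anti k) (fun i hi => ?_)
      fun i => (hA.le_final k i).trans ((hα.le i).trans hm)
    have := hA.le_final k i
    rw [hα.zero i hi] at this
    omega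
  refine Finset.sum_nbij' (fun A k => conjFun n (A k)) (fun A k => conjFun n (A k)) ?_ ?_ ?_ ?_ ?_
  · intro A hA
    rw [vChains, Finset.mem_filter, mem_shapeChains hα.zero] at hA
    rw [hChains, Finset.mem_filter, mem_shapeChains hα'.zero]
    refine ⟨hA.1.conj, fun k i => ?_⟩
    refine Finset.card_le_card <| Finset.monotone_filter_right _ fun j _ h => ?_
    have := hA.2 k j
    omega
  · intro B hB
    rw [hChains, Finset.mem_filter, mem_shapeChains hα'.zero] at hB
    rw [vChains, Finset.mem_filter, mem_shapeChains hα.zero]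
    have h := hB.1.conj
    rw [hα.conj_conj hm] at h
    refine ⟨h, fun k i => ?_⟩
    by_contra hcon
    push Not at hcon
    have h1 := (lt_conjFun_iff (hB.1.anti (k + 1))).1 hcon
    have h2 := hB.2 k (conjFun n (B k) i)
    have h3 := mt (lt_conjFun_iff (n := n) (hB.1.anti k) (i := conjFun n (B k) i) (j := i)).2
      (lt_irrefl _)
    have h4 : conjFun n (B k) i < n := by omega
    exact h3 ⟨h4, h1.2.trans_le h2⟩
  · intro A hA
    rw [vChains, Finset.mem_filter, mem_shapeChains hα.zero] at hA
    exact hcc α A hα hA.1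
  · intro B hB
    rw [hChains, Finset.mem_filter, mem_shapeChains hα'.zero] at hB
    exact hcc _ B hα' hB.1
  · intro A hA
    rw [vChains, Finset.mem_filter, mem_shapeChains hα.zero] at hA
    rw [chainCont_conjFun hα hm hA.1]

/-- The degree `m` part of `∏ (1 + x i * y j)`. -/
def dualCauchy {R : Type*} [CommRing R] {n : ℕ} (m : ℕ) (x y : Fin n → R) : R :=
  ∑ B ∈ Finset.powersetCard m (Finset.univ : Finset (Fin n × Fin n)), ∏ p ∈ B, x p.1 * y p.2

theorem dualCauchy_eq_sum {R : Type*} [CommRing R] {n : ℕ} (m : ℕ) (x y : Fin n → R) :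
    dualCauchy m x y =
      ∑ c ∈ hSet n m, (∏ k, monoSum x (eSet n (c k))) * ∏ k, y k ^ c k := by
  obtain ⟨P, hP⟩ : ∃ P : (Fin n → Fin n → ℕ) → Prop, ∀ d, P d := ⟨fun _ => True, fun _ => trivial⟩
  have h1 : ∀ c : Fin n → ℕ, (∏ k, monoSum x (eSet n (c k))) * ∏ k, y k ^ c k =
      ∑ d ∈ Fintype.piFinset (fun k => eSet n (c k)) with P d,
        (∏ k, ∏ i, x i ^ d k i) * ∏ k, y k ^ c k := by
    intro c
    simp only [monoSum, Finset.prod_univ_sum, Finset.sum_mul,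
      Finset.filter_true_of_mem fun d _ => hP d]
  rw [Finset.sum_congr rfl fun c _ => h1 c,
    sum_hSet_sum_piFinset (S := eSet n) (fun c d h => (mem_eSet.1 h).1) P
      (fun c d => (∏ k, ∏ i, x i ^ d k i) * ∏ k, y k ^ c k)]
  unfold dualCauchy
  refine Finset.sum_nbij' (fun B k i => if (i, k) ∈ B then 1 else 0)
    (fun d => Finset.univ.filter fun p : Fin n × Fin n => d p.2 p.1 = 1) ?_ ?_ ?_ ?_ ?_
  · intro B hB
    rw [Finset.mem_powersetCard] at hB
    rw [Finset.mem_filter, mem_stepSet]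
    refine ⟨?_, hP _, fun k => mem_eSet.2 ⟨rfl, fun i => by dsimp only; split_ifs <;> simp⟩⟩
    rw [Finset.sum_comm, ← Fintype.sum_prod_type' (fun i k => if (i, k) ∈ B then 1 else 0)]
    simp [hB.2]
  · intro d hd
    rw [Finset.mem_filter, mem_stepSet] at hd
    rw [Finset.mem_powersetCard]
    refine ⟨Finset.subset_univ _, ?_⟩
    rw [Finset.card_filter, ← hd.1, Finset.sum_comm, ← Fintype.sum_prod_type' (fun i k => d k i)]
    refine Finset.sum_congr rfl fun p _ => ?_
    have := (mem_eSet.1 (hd.2.2 p.2)).2 p.1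
    split_ifs <;> omega
  · intro B _
    ext p
    simp
  · intro d hd
    rw [Finset.mem_filter] at hd
    ext k i
    have := (mem_eSet.1 (hd.2.2 k)).2 i
    simp only [Finset.mem_filter, Finset.mem_univ, true_and]
    split_ifs <;> omega
  · intro B _
    have h2 : ∀ k, ∏ i, y k ^ (if (i, k) ∈ B then 1 else 0) =
        y k ^ ∑ i, (if (i, k) ∈ B then 1 else 0) := fun k => Finset.prod_pow_eq_pow_sum _ _ _
    simp only [← h2, ← Finset.prod_mul_distrib]
    rw [Finset.prod_comm, ← Fintype.prod_prod_type' (fun i k =>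
      x i ^ (if (i, k) ∈ B then 1 else 0) * y k ^ (if (i, k) ∈ B then 1 else 0))]
    rw [← Finset.prod_subset (Finset.subset_univ B)]
    · exact Finset.prod_congr rfl fun p hp => by simp [hp]
    · intro p _ hp
      simp [hp]

theorem goodE_shift_iff {n : ℕ} {μ α : ℕ → ℕ} {A : ℕ → ℕ → ℕ} (hA : IsShapeChain n μ α A)
    (hα : ∀ i, n ≤ i → α i = 0) :
    (∀ k, chainSteps n A k ∈ eSet n (∑ i, chainSteps n A k i)) ↔
      ∀ k i, A (k + 1) i ≤ A k i + 1 := by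
  constructor
  · intro h k i
    by_cases hk : k < n
    · by_cases hi : i < n
      · have := (mem_eSet.1 (h ⟨k, hk⟩)).2 ⟨i, hi⟩
        simp only [chainSteps] at this
        omega
      · have := hA.le_final (k + 1) i
        rw [hα i (by omega)] at this
        omega
    · rw [hA.final (k + 1) _ (by omega), ← hA.final k _ (by omega)]
      omega
  · intro h k
    refine mem_eSet.2 ⟨rfl, fun i => ?_⟩
    have := h k i
    simp only [chainSteps]
    omega

theorem alternant_mul_alternant_mul_dualCauchy {R : Type*} [CommRing R] {n m : ℕ} (hm : m ≤ n)
    (x y : Fin n → R) :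
    alternant x (shift n fun _ => 0) * alternant y (shift n fun _ => 0) * dualCauchy m x y =
      ∑ b ∈ parSet n m, alternant x (shift n b) * alternant y (shift n (conjFun n b)) := by
  have h0 : IsStrictDecr (shift n fun _ => 0) := isStrictDecr_shift.2 fun _ _ => le_rfl
  rw [dualCauchy_eq_sum, mul_assoc, alternant_mul_sum y _ (isSymmSet_hSet n m)
    (fun c => ∏ k, monoSum x (eSet n (c k)))
    (fun σ d => Equiv.prod_comp σ fun k => monoSum x (eSet n (d k))), Finset.mul_sum]
  have h1 : ∀ c : Fin n → ℕ, alternant x (shift n fun _ => 0) *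
      ((∏ k, monoSum x (eSet n (c k))) * alternant y ((shift n fun _ => 0) + c)) =
      ∑ d ∈ Fintype.piFinset (fun k => eSet n (c k)) with AllGood GoodE (shift n fun _ => 0) d,
        alternant x ((shift n fun _ => 0) + ∑ k, d k) *
          alternant y ((shift n fun _ => 0) + c) := by
    intro c
    rw [← mul_assoc, alternant_mul_prod_monoSum x _ fun k => isSymmSet_eSet n (c k),
      sum_piFinset_eSet (isAlternating_alternant x) c h0, Finset.sum_mul]
  rw [Finset.sum_congr rfl fun c _ => h1 c,
    sum_hSet_sum_piFinset (S := eSet n) (fun c d h => (mem_eSet.1 h).1), ← Finset.filter_filter,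
    Finset.sum_filter, sum_allGood_eq_sum_shapeChains (isPar_zero n), zero_add]
  refine Finset.sum_congr rfl fun b hb => ?_
  rw [mem_parSet] at hb
  rw [← sum_vChains_zero (isAlternating_alternant y) hb hm, vChains, Finset.mul_sum,
    Finset.sum_filter]
  refine Finset.sum_congr rfl fun A hA => ?_
  rw [mem_shapeChains hb.zero] at hA
  simp only [goodE_shift_iff hA hb.zero]
  refine if_congr Iff.rfl ?_ rfl
  rw [← partialSum_of_le _ le_rfl, shift_add_partialSum hA,
    show A n = b from funext fun i => hA.final n i le_rfl]
  congr 2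
  ext k
  simp only [Pi.add_apply, shift, sum_chainSteps]
  omega

/-! ### Littlewood–Richardson tableaux and lattice chains -/

theorem card_subtype_prod_eq_sum {P : ℕ → ℕ → Prop} {N M : ℕ}
    (hP : ∀ i j, P i j → i < N ∧ j < M) :
    Nat.card {p : ℕ × ℕ // P p.1 p.2} = ∑ i ∈ Finset.range N, #{j ∈ Finset.range M | P i j} := by
  rw [Nat.subtype_card ((Finset.range N ×ˢ Finset.range M).filter fun p => P p.1 p.2),
    Finset.card_filter, Finset.sum_product]
  · simp only [Finset.card_filter]
  · intro p
    simp only [Finset.mem_filter, Finset.mem_product, Finset.mem_range]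
    exact ⟨fun h => h.2, fun h => ⟨hP _ _ h, h⟩⟩

/-- The number of cells in row `i` of `α / μ` with entry `k`. -/
def rowCount (μ α : ℕ → ℕ) (T : ℕ → ℕ → ℕ) (i k : ℕ) : ℕ :=
  #{j ∈ Finset.range (α i) | μ i ≤ j ∧ T i j = k}

/-- The chain of shapes occupied by the entries less than `k`. -/
def chainOfTab (μ α : ℕ → ℕ) (T : ℕ → ℕ → ℕ) : ℕ → ℕ → ℕ :=
  fun k i => μ i + #{j ∈ Finset.range (α i) | μ i ≤ j ∧ T i j < k}

/-- The filling recording the step at which a cell enters the chain. -/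
def tabOfChain (n : ℕ) (μ α : ℕ → ℕ) (A : ℕ → ℕ → ℕ) : ℕ → ℕ → ℕ :=
  fun i j => if μ i ≤ j ∧ j < α i then #{k ∈ Finset.range n | A (k + 1) i ≤ j} else 0

section Tableau

variable {n : ℕ} {μ α : ℕ → ℕ} {T : ℕ → ℕ → ℕ} {A : ℕ → ℕ → ℕ}

theorem chainOfTab_succ (k i : ℕ) :
    chainOfTab μ α T (k + 1) i = chainOfTab μ α T k i + rowCount μ α T i k := by
  unfold chainOfTab rowCount
  rw [add_assoc, ← Finset.card_union_of_disjoint]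
  · congr 2
    ext j
    simp only [Finset.mem_filter, Finset.mem_union, Finset.mem_range]
    omega
  · rw [Finset.disjoint_filter]
    intro j _ h
    omega

theorem letterCount_chainOfTab (k i : ℕ) :
    letterCount (chainOfTab μ α T) k i = (∑ p ∈ Finset.range i, rowCount μ α T p k : ℕ) := by
  unfold letterCount
  push_cast
  refine Finset.sum_congr rfl fun p _ => ?_
  rw [chainOfTab_succ]
  push_cast
  ring

theorem chainCont_chainOfTab (n k : ℕ) :
    chainCont n (chainOfTab μ α T) k = ∑ p ∈ Finset.range n, rowCount μ α T p k := by
  unfold chainCont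
  refine Finset.sum_congr rfl fun p _ => ?_
  rw [chainOfTab_succ]
  omega

theorem le_of_row (hα : ∀ i, α (i + 1) ≤ α i) {i j : ℕ} (h : j < α i) : j < α 0 :=
  h.trans_le (antitone_nat_of_succ_le hα (Nat.zero_le i))

theorem lt_of_row (hz : ∀ i, n ≤ i → α i = 0) {i j : ℕ} (h : j < α i) : i < n := by
  by_contra hi
  rw [hz i (by omega)] at h
  omega

theorem skewContent_eq (hα : ∀ i, α (i + 1) ≤ α i) (hz : ∀ i, n ≤ i → α i = 0) (k : ℕ) :
    skewContent α μ T k = ∑ p ∈ Finset.range n, rowCount μ α T p k := by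
  unfold skewContent
  rw [card_subtype_prod_eq_sum (P := fun i j => μ i ≤ j ∧ j < α i ∧ T i j = k) (N := n)
    (M := α 0) fun i j h => ⟨lt_of_row hz h.2.1, le_of_row hα h.2.1⟩]
  refine Finset.sum_congr rfl fun i _ => congrArg _ ?_
  ext j
  have := le_of_row hα (i := i) (j := j)
  simp only [Finset.mem_filter, Finset.mem_range]
  tauto

theorem lrCount_eq (hα : ∀ i, α (i + 1) ≤ α i) (i j k : ℕ) :
    lrCount α μ T i j k = ∑ p ∈ Finset.range i, rowCount μ α T p k +
      #{j' ∈ Finset.range (α i) | j ≤ j' ∧ μ i ≤ j' ∧ T i j' = k} := by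
  unfold lrCount
  rw [card_subtype_prod_eq_sum (P := fun i' j' => (i' < i ∨ (i' = i ∧ j ≤ j')) ∧
    μ i' ≤ j' ∧ j' < α i' ∧ T i' j' = k) (N := i + 1) (M := α 0)
    fun i' j' h => ⟨by omega, le_of_row hα h.2.2.1⟩, Finset.sum_range_succ]
  congr 1
  · refine Finset.sum_congr rfl fun p hp => congrArg _ ?_
    rw [Finset.mem_range] at hp
    ext j'
    have := le_of_row hα (i := p) (j := j')
    simp only [Finset.mem_filter, Finset.mem_range]
    tauto
  · refine congrArg _ ?_
    ext j'
    have := le_of_row hα (i := i) (j := j')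
    simp only [Finset.mem_filter, Finset.mem_range, lt_irrefl, true_and, false_or]
    tauto

theorem lt_chainOfTab_iff
    (hrow : ∀ i j₁ j₂, μ i ≤ j₁ → j₁ ≤ j₂ → j₂ < α i → T i j₁ ≤ T i j₂)
    {i j k : ℕ} (h1 : μ i ≤ j) (h2 : j < α i) : j < chainOfTab μ α T k i ↔ T i j < k := by
  unfold chainOfTab
  constructor
  · intro h
    by_contra hcon
    have hsub : (Finset.range (α i)).filter (fun j => μ i ≤ j ∧ T i j < k) ⊆
        Finset.Ico (μ i) j := by
      intro j' hj'
      rw [Finset.mem_filter, Finset.mem_range] at hj'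
      rw [Finset.mem_Ico]
      refine ⟨hj'.2.1, ?_⟩
      by_contra hlt
      have := hrow i j j' h1 (by omega) hj'.1
      omega
    have := Finset.card_le_card hsub
    rw [Nat.card_Ico] at this
    omega
  · intro h
    have hsub : Finset.Icc (μ i) j ⊆
        (Finset.range (α i)).filter (fun j => μ i ≤ j ∧ T i j < k) := by
      intro j' hj'
      rw [Finset.mem_Icc] at hj'
      rw [Finset.mem_filter, Finset.mem_range]
      have := hrow i j' j hj'.1 hj'.2 h2
      omega
    have := Finset.card_le_card hsub
    rw [Nat.card_Icc] at this
    omega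

theorem IsLR.entry_le (hα : ∀ i, α (i + 1) ≤ α i) (hT : IsLR α μ T) :
    ∀ i j, μ i ≤ j → j < α i → T i j ≤ i := by
  intro i
  induction i using Nat.strong_induction_on with
  | _ i ih =>
    intro j h1 h2
    by_contra hcon
    obtain ⟨k, hk⟩ : ∃ k, T i j = k + 1 := ⟨T i j - 1, by omega⟩
    have h := hT.2.2.2 i j k
    rw [lrCount_eq hα, lrCount_eq hα] at h
    have h3 : ∑ p ∈ Finset.range i, rowCount μ α T p k = 0 := by
      refine Finset.sum_eq_zero fun p hp => ?_
      rw [Finset.mem_range] at hp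
      refine Finset.card_eq_zero.2 (Finset.filter_eq_empty_iff.2 fun j' hj' hc => ?_)
      have := ih p hp j' hc.1 (Finset.mem_range.1 hj')
      omega
    have h4 : (Finset.range (α i)).filter (fun j' => j ≤ j' ∧ μ i ≤ j' ∧ T i j' = k) = ∅ := by
      refine Finset.filter_eq_empty_iff.2 fun j' hj' hc => ?_
      have := hT.2.1 i j j' h1 hc.1 (Finset.mem_range.1 hj')
      omega
    have h5 : 0 < #{j' ∈ Finset.range (α i) | j ≤ j' ∧ μ i ≤ j' ∧ T i j' = k + 1} :=
      Finset.card_pos.2 ⟨j, Finset.mem_filter.2 ⟨Finset.mem_range.2 h2, le_rfl, h1, hk⟩⟩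
    rw [h3, h4, Finset.card_empty] at h
    omega

theorem chainOfTab_le (hμα : ∀ i, μ i ≤ α i) (k i : ℕ) : chainOfTab μ α T k i ≤ α i := by
  have hsub : (Finset.range (α i)).filter (fun j => μ i ≤ j ∧ T i j < k) ⊆
      Finset.Ico (μ i) (α i) := by
    intro j
    simp only [Finset.mem_filter, Finset.mem_range, Finset.mem_Ico]
    omega
  have := Finset.card_le_card hsub
  have := hμα i
  rw [Nat.card_Ico] at *
  unfold chainOfTab
  omega

theorem IsLR.isHChain (hμ : ∀ i, μ (i + 1) ≤ μ i) (hα : ∀ i, α (i + 1) ≤ α i)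
    (hz : ∀ i, n ≤ i → α i = 0) (hμα : ∀ i, μ i ≤ α i) (hT : IsLR α μ T) :
    IsHChain n μ α (chainOfTab μ α T) := by
  refine ⟨fun i => ?_, fun k i hk => ?_, fun k i => ?_, fun k i => ?_⟩
  · simp [chainOfTab]
  · have : (Finset.range (α i)).filter (fun j => μ i ≤ j ∧ T i j < k) =
        Finset.Ico (μ i) (α i) := by
      ext j
      simp only [Finset.mem_filter, Finset.mem_range, Finset.mem_Ico]
      constructor
      · omega
      · rintro ⟨h1, h2⟩
        have := hT.entry_le hα i j h1 h2
        have := lt_of_row hz h2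
        omega
    have := hμα i
    unfold chainOfTab
    rw [‹Finset.filter _ _ = _›, Nat.card_Ico]
    omega
  · rw [chainOfTab_succ]
    omega
  · by_contra hcon
    push Not at hcon
    have h1 : μ i ≤ chainOfTab μ α T k i := Nat.le_add_right _ _
    have h2 := chainOfTab_le (T := T) hμα (k + 1) (i + 1)
    have h3 := hα i
    have h4 := hμ i
    have h5 := (lt_chainOfTab_iff hT.2.1 (h4.trans h1) (hcon.trans_le h2)).1 hcon
    have h6 := hT.2.2.1 i (i + 1) _ (Nat.lt_succ_self i) h1
      (hcon.trans_le (h2.trans h3)) (h4.trans h1) (hcon.trans_le h2)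
    have h7 := (lt_chainOfTab_iff hT.2.1 (k := k) h1 (hcon.trans_le (h2.trans h3))).2 (by omega)
    exact lt_irrefl _ h7

theorem IsLR.isLattice (hα : ∀ i, α (i + 1) ≤ α i) (hT : IsLR α μ T) :
    IsLattice (chainOfTab μ α T) := by
  intro k i
  rw [letterCount_chainOfTab, letterCount_chainOfTab, Finset.sum_range_succ]
  have h := hT.2.2.2 i (chainOfTab μ α T (k + 1) i) k
  rw [lrCount_eq hα, lrCount_eq hα] at h
  have h1 : (Finset.range (α i)).filter
      (fun j => chainOfTab μ α T (k + 1) i ≤ j ∧ μ i ≤ j ∧ T i j = k) = ∅ := by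
    refine Finset.filter_eq_empty_iff.2 fun j hj hc => ?_
    have := (lt_chainOfTab_iff hT.2.1 (k := k + 1) hc.2.1 (Finset.mem_range.1 hj)).2 (by omega)
    omega
  have h2 : (Finset.range (α i)).filter
      (fun j => chainOfTab μ α T (k + 1) i ≤ j ∧ μ i ≤ j ∧ T i j = k + 1) =
      (Finset.range (α i)).filter (fun j => μ i ≤ j ∧ T i j = k + 1) := by
    refine Finset.filter_congr fun j hj => ⟨fun hc => hc.2, fun hc => ⟨?_, hc⟩⟩
    by_contra hlt
    have := (lt_chainOfTab_iff hT.2.1 hc.1 (Finset.mem_range.1 hj)).1 (not_le.1 hlt)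
    omega
  rw [h1, h2, Finset.card_empty] at h
  unfold rowCount at *
  exact_mod_cast h

theorem lrCount_le_of_isLattice (hα : ∀ i, α (i + 1) ≤ α i)
    (hl : IsLattice (chainOfTab μ α T)) (i j k : ℕ) :
    lrCount α μ T i j (k + 1) ≤ lrCount α μ T i j k := by
  have h := hl k i
  rw [letterCount_chainOfTab, letterCount_chainOfTab, Finset.sum_range_succ] at h
  rw [lrCount_eq hα, lrCount_eq hα]
  have h1 : #{j' ∈ Finset.range (α i) | j ≤ j' ∧ μ i ≤ j' ∧ T i j' = k + 1} ≤
      rowCount μ α T i (k + 1) :=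
    Finset.card_le_card <| Finset.monotone_filter_right _ fun j _ h => h.2
  have h2 : ∑ p ∈ Finset.range i, rowCount μ α T p (k + 1) + rowCount μ α T i (k + 1) ≤
      ∑ p ∈ Finset.range i, rowCount μ α T p k := by exact_mod_cast h
  omega

theorem IsHChain.monotone (hA : IsHChain n μ α A) (i : ℕ) : Monotone fun k => A k i :=
  monotone_nat_of_le_succ fun k => hA.mono k i

theorem tabOfChain_lt_iff (hA : IsHChain n μ α A) {i j k : ℕ} (h1 : μ i ≤ j) (h2 : j < α i) :
    tabOfChain n μ α A i j < k ↔ j < A k i := by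
  rw [tabOfChain, if_pos ⟨h1, h2⟩]
  constructor
  · intro h
    by_contra hcon
    push Not at hcon
    have hk : k ≤ n := by
      by_contra hk
      rw [hA.final k i (by omega)] at hcon
      omega
    have hsub : Finset.range k ⊆ (Finset.range n).filter (fun k => A (k + 1) i ≤ j) := by
      intro k' hk'
      rw [Finset.mem_range] at hk'
      rw [Finset.mem_filter, Finset.mem_range]
      exact ⟨by omega, (hA.monotone i (show k' + 1 ≤ k by omega)).trans hcon⟩
    have := Finset.card_le_card hsub
    rw [Finset.card_range] at this
    omega
  · intro h
    have hk : 0 < k := by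
      by_contra hk
      rw [show k = 0 by omega, hA.init] at h
      omega
    have hsub : (Finset.range n).filter (fun k => A (k + 1) i ≤ j) ⊆ Finset.range (k - 1) := by
      intro k' hk'
      rw [Finset.mem_filter] at hk'
      rw [Finset.mem_range]
      by_contra hlt
      have : A k i ≤ A (k' + 1) i := hA.monotone i (by omega)
      omega
    have := Finset.card_le_card hsub
    rw [Finset.card_range] at this
    omega

theorem chainOfTab_tabOfChain (hA : IsHChain n μ α A) :
    chainOfTab μ α (tabOfChain n μ α A) = A := by
  ext k i
  have : (Finset.range (α i)).filter (fun j => μ i ≤ j ∧ tabOfChain n μ α A i j < k) =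
      Finset.Ico (μ i) (A k i) := by
    ext j
    simp only [Finset.mem_filter, Finset.mem_range, Finset.mem_Ico]
    constructor
    · rintro ⟨h1, h2, h3⟩
      exact ⟨h2, (tabOfChain_lt_iff hA h2 h1).1 h3⟩
    · rintro ⟨h1, h2⟩
      have h3 := h2.trans_le (hA.le_final k i)
      exact ⟨h3, h1, (tabOfChain_lt_iff hA h1 h3).2 h2⟩
  have h := hA.isShapeChain.init_le k i
  unfold chainOfTab
  rw [this, Nat.card_Ico]
  omega

theorem tabOfChain_chainOfTab (hα : ∀ i, α (i + 1) ≤ α i) (hz : ∀ i, n ≤ i → α i = 0)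
    (hT : IsLR α μ T) : tabOfChain n μ α (chainOfTab μ α T) = T := by
  ext i j
  unfold tabOfChain
  split_ifs with h
  · have : (Finset.range n).filter (fun k => chainOfTab μ α T (k + 1) i ≤ j) =
        Finset.range (T i j) := by
      ext k
      have h1 := lt_chainOfTab_iff hT.2.1 (k := k + 1) h.1 h.2
      have h2 := hT.entry_le hα i j h.1 h.2
      have h3 := lt_of_row hz h.2
      simp only [Finset.mem_filter, Finset.mem_range]
      omega
    rw [this, Finset.card_range]
  · exact (hT.1 i j h).symm

theorem isLR_tabOfChain (hα : ∀ i, α (i + 1) ≤ α i) (hA : IsHChain n μ α A)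
    (hl : IsLattice A) : IsLR α μ (tabOfChain n μ α A) := by
  refine ⟨fun i j h => if_neg h, fun i j₁ j₂ h1 h2 h3 => ?_, fun i₁ i₂ j hi h1 h2 h3 h4 => ?_, ?_⟩
  · rw [tabOfChain, tabOfChain, if_pos ⟨h1, by omega⟩, if_pos ⟨by omega, h3⟩]
    exact Finset.card_le_card <| Finset.monotone_filter_right _ fun k _ h => h.trans h2
  · rw [tabOfChain_lt_iff hA h1 h2]
    have h5 := (tabOfChain_lt_iff hA h3 h4).1 (Nat.lt_succ_self _)
    refine h5.trans_le (le_trans ?_ (hA.strip _ i₁))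
    exact antitone_nat_of_succ_le (hA.antitone _) (by omega)
  · refine lrCount_le_of_isLattice hα ?_
    rwa [chainOfTab_tabOfChain hA]

end Tableau

/-- Littlewood–Richardson tableaux of given content correspond to lattice chains. -/
def isLREquiv {n : ℕ} {μ α : ℕ → ℕ} (hμ : ∀ i, μ (i + 1) ≤ μ i)
    (hα : ∀ i, α (i + 1) ≤ α i) (hz : ∀ i, n ≤ i → α i = 0) (hμα : ∀ i, μ i ≤ α i)
    (b : ℕ → ℕ) :
    {T : ℕ → ℕ → ℕ // IsLR α μ T ∧ skewContent α μ T = b} ≃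
      {A // A ∈ (hChains n μ α).filter fun A => IsLattice A ∧ chainCont n A = b} :=
  have hcont : ∀ T, skewContent α μ T = chainCont n (chainOfTab μ α T) := fun T =>
    funext fun k => (skewContent_eq hα hz k).trans (chainCont_chainOfTab n k).symm
  have hmem : ∀ A, A ∈ (hChains n μ α).filter (fun A => IsLattice A ∧ chainCont n A = b) ↔
      IsHChain n μ α A ∧ IsLattice A ∧ chainCont n A = b := fun A => by
    rw [Finset.mem_filter, mem_hChains hz]
  { toFun := fun T => ⟨chainOfTab μ α T.1, (hmem _).2 ⟨T.2.1.isHChain hμ hα hz hμα,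
      T.2.1.isLattice hα, (hcont _).symm.trans T.2.2⟩⟩
    invFun := fun A => ⟨tabOfChain n μ α A.1,
      isLR_tabOfChain hα ((hmem _).1 A.2).1 ((hmem _).1 A.2).2.1, by
        rw [hcont, chainOfTab_tabOfChain ((hmem _).1 A.2).1, ((hmem _).1 A.2).2.2]⟩
    left_inv := fun T => Subtype.ext (tabOfChain_chainOfTab hα hz T.2.1)
    right_inv := fun A => Subtype.ext (chainOfTab_tabOfChain ((hmem _).1 A.2).1) }

theorem card_isLR_eq_lrCoeff {n : ℕ} {μ α : ℕ → ℕ} (hμ : ∀ i, μ (i + 1) ≤ μ i)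
    (hα : ∀ i, α (i + 1) ≤ α i) (hz : ∀ i, n ≤ i → α i = 0) (hμα : ∀ i, μ i ≤ α i)
    (b : ℕ → ℕ) :
    Nat.card {T : ℕ → ℕ → ℕ // IsLR α μ T ∧ skewContent α μ T = b} = lrCoeff n μ α b := by
  rw [Nat.card_congr (isLREquiv hμ hα hz hμα b), Nat.card_eq_fintype_card, Fintype.card_coe,
    lrCoeff]

/-! ### Multitableaux and products of Schur functions -/

theorem IsHChain.sum_chainCont {n : ℕ} {μ α : ℕ → ℕ} {A : ℕ → ℕ → ℕ} (hA : IsHChain n μ α A) :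
    ∑ i ∈ Finset.range n, μ i + ∑ k ∈ Finset.range n, chainCont n A k =
      ∑ i ∈ Finset.range n, α i := by
  simp only [chainCont]
  rw [Finset.sum_comm, ← Finset.sum_add_distrib]
  refine Finset.sum_congr rfl fun i _ => ?_
  rw [Finset.sum_range_tsub (hA.monotone i), hA.init, hA.final n i le_rfl]
  have := hA.isShapeChain.init_le n i
  rw [hA.final n i le_rfl] at this
  omega

theorem sum_add_skewSize {n : ℕ} {μ α : ℕ → ℕ} (hα : ∀ i, α (i + 1) ≤ α i)
    (hz : ∀ i, n ≤ i → α i = 0) (hμα : ∀ i, μ i ≤ α i) :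
    ∑ i ∈ Finset.range n, μ i + skewSize α μ = ∑ i ∈ Finset.range n, α i := by
  unfold skewSize
  rw [card_subtype_prod_eq_sum (P := fun i j => μ i ≤ j ∧ j < α i) (N := n)
    (M := α 0) fun i j h => ⟨lt_of_row hz h.2, le_of_row hα h.2⟩, ← Finset.sum_add_distrib]
  refine Finset.sum_congr rfl fun i _ => ?_
  have hcard : ∀ s : Finset ℕ, (∀ j, j ∈ s ↔ μ i ≤ j ∧ j < α i) → μ i + #s = α i := by
    intro s hs
    rw [show s = Finset.Ico (μ i) (α i) by ext j; rw [hs, Finset.mem_Ico], Nat.card_Ico]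
    have := hμα i
    omega
  refine hcard _ fun j => ?_
  have := le_of_row hα (i := i) (j := j)
  simp only [Finset.mem_filter, Finset.mem_range]
  tauto

theorem IsLR.isPar_skewContent {n : ℕ} {μ α : ℕ → ℕ} {T : ℕ → ℕ → ℕ}
    (hμ : ∀ i, μ (i + 1) ≤ μ i) (hα : ∀ i, α (i + 1) ≤ α i) (hz : ∀ i, n ≤ i → α i = 0)
    (hμα : ∀ i, μ i ≤ α i) (hT : IsLR α μ T) :
    IsPar n (skewSize α μ) (skewContent α μ T) := by
  have hA := hT.isHChain hμ hα hz hμα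
  have hcont : skewContent α μ T = chainCont n (chainOfTab μ α T) :=
    funext fun k => (skewContent_eq hα hz k).trans (chainCont_chainOfTab n k).symm
  rw [hcont]
  refine ⟨hA.chainCont_anti hz (hT.isLattice hα), fun i hi => hA.chainCont_of_le hi, ?_⟩
  have := hA.sum_chainCont
  have := sum_add_skewSize hα hz hμα
  omega

namespace LRMultiF

variable {n r : ℕ} {α : ℕ → ℕ}

theorem ext' {M N : LRMultiF r α} (h1 : M.chain = N.chain) (h2 : M.T = N.T) : M = N := by
  cases M
  cases N
  cases h1
  cases h2
  rfl

theorem chain_le (M : LRMultiF r α) (k : Fin (r + 1)) (i : ℕ) : M.chain k i ≤ α i := by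
  rw [← M.last i]
  have : Monotone fun k => M.chain k i := Fin.monotone_iff_le_succ.2 fun k => M.mono k i
  exact this (Fin.le_last k)

theorem chain_eq_zero (M : LRMultiF r α) (hz : ∀ i, n ≤ i → α i = 0) (k : Fin (r + 1)) (i : ℕ)
    (hi : n ≤ i) : M.chain k i = 0 :=
  Nat.le_zero.1 ((M.chain_le k i).trans_eq (hz i hi))

theorem isPar_cont (M : LRMultiF r α) (hz : ∀ i, n ≤ i → α i = 0) (k : Fin r) :
    IsPar n (M.size k) (M.cont k) :=
  (M.lr k).isPar_skewContent (fun i => M.antitone _ _ _ (Nat.le_succ i))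
    (fun i => M.antitone _ _ _ (Nat.le_succ i)) (M.chain_eq_zero hz _) (M.mono k)

/-- Multitableaux with prescribed content. -/
abbrev WithCont (α : ℕ → ℕ) (ρ : Fin r → ℕ → ℕ) : Type :=
  {M : LRMultiF r α // ∀ k, M.cont k = ρ k}

/-- Removing the last tableau. -/
def init (M : LRMultiF (r + 1) α) : LRMultiF r (M.chain (Fin.last r).castSucc) where
  chain k := M.chain k.castSucc
  antitone k := M.antitone k.castSucc
  zero := M.zero
  last _ := rfl
  mono k := M.mono k.castSucc
  T k := M.T k.castSucc
  lr k := M.lr k.castSucc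

/-- Adding one more tableau. -/
def snoc {β : ℕ → ℕ} (hα : ∀ i, α (i + 1) ≤ α i) (hβα : ∀ i, β i ≤ α i) (M : LRMultiF r β)
    (T : ℕ → ℕ → ℕ) (hT : IsLR α β T) : LRMultiF (r + 1) α where
  chain := Fin.snoc (α := fun _ => ℕ → ℕ) M.chain α
  antitone k := by
    refine Fin.lastCases ?_ (fun k => ?_) k
    · rw [Fin.snoc_last]
      exact fun i j h => antitone_nat_of_succ_le hα h
    · rw [Fin.snoc_castSucc]
      exact M.antitone k
  zero i := by
    rw [← Fin.castSucc_zero, Fin.snoc_castSucc]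
    exact M.zero i
  last i := by rw [Fin.snoc_last]
  mono k := by
    refine Fin.lastCases ?_ (fun k => ?_) k
    · rw [Fin.succ_last, Fin.snoc_last, Fin.snoc_castSucc]
      intro i
      rw [M.last]
      exact hβα i
    · rw [← Fin.castSucc_succ, Fin.snoc_castSucc, Fin.snoc_castSucc]
      exact M.mono k
  T := Fin.snoc (α := fun _ => ℕ → ℕ → ℕ) M.T T
  lr k := by
    refine Fin.lastCases ?_ (fun k => ?_) k
    · rw [Fin.succ_last, Fin.snoc_last, Fin.snoc_castSucc, Fin.snoc_last,
        show M.chain (Fin.last r) = β from funext M.last]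
      exact hT
    · rw [← Fin.castSucc_succ, Fin.snoc_castSucc, Fin.snoc_castSucc, Fin.snoc_castSucc]
      exact M.lr k

/-- Multitableaux with prescribed content and penultimate shape are pairs consisting of a
multitableau and a single tableau. -/
def withContEquiv {β : ℕ → ℕ} (hα : ∀ i, α (i + 1) ≤ α i) (hβα : ∀ i, β i ≤ α i)
    (ρ : Fin (r + 1) → ℕ → ℕ) :
    {M : WithCont α ρ // M.1.chain (Fin.last r).castSucc = β} ≃
      WithCont β (fun k => ρ k.castSucc) ×
        {T : ℕ → ℕ → ℕ // IsLR α β T ∧ skewContent α β T = ρ (Fin.last r)} where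
  toFun M := ⟨⟨M.2 ▸ M.1.1.init, by
    obtain ⟨M, rfl⟩ := M
    exact fun k => M.2 k.castSucc⟩, ⟨M.1.1.T (Fin.last r), by
    obtain ⟨⟨M, hM⟩, rfl⟩ := M
    have h1 := M.lr (Fin.last r)
    have h2 := hM (Fin.last r)
    rw [cont] at h2
    rw [Fin.succ_last, show M.chain (Fin.last (r + 1)) = α from funext M.last] at h1 h2
    exact ⟨h1, h2⟩⟩⟩
  invFun x := ⟨⟨snoc hα hβα x.1.1 x.2.1 x.2.2.1, fun k => by
    unfold cont snoc
    refine Fin.lastCases ?_ (fun k => ?_) k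
    · simp only [Fin.succ_last, Fin.snoc_last, Fin.snoc_castSucc]
      rw [show x.1.1.chain (Fin.last r) = β from funext x.1.1.last]
      exact x.2.2.2
    · simp only [← Fin.castSucc_succ, Fin.snoc_castSucc]
      exact x.1.2 k⟩, by
    simp only [snoc, Fin.snoc_castSucc]
    exact funext x.1.1.last⟩
  left_inv := by
    rintro ⟨⟨M, hM⟩, rfl⟩
    refine Subtype.ext (Subtype.ext (ext' ?_ ?_))
    · funext k
      refine Fin.lastCases ?_ (fun k => ?_) k
      · simp only [snoc, Fin.snoc_last]
        exact (funext M.last).symm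
      · simp only [snoc, Fin.snoc_castSucc]
        rfl
    · funext k
      refine Fin.lastCases ?_ (fun k => ?_) k
      · simp only [snoc, Fin.snoc_last]
      · simp only [snoc, Fin.snoc_castSucc]
        rfl
  right_inv := by
    rintro ⟨⟨M, hM⟩, ⟨T, hT⟩⟩
    have key : ∀ (γ : ℕ → ℕ) (N : LRMultiF r γ) (h : γ = β), N.chain = M.chain → N.T = M.T →
        h ▸ N = M := by
      rintro γ N rfl h1 h2
      exact ext' h1 h2
    refine Prod.ext (Subtype.ext (key _ _ _ ?_ ?_)) (Subtype.ext ?_)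
    · funext k
      simp only [snoc, init, Fin.snoc_castSucc]
    · funext k
      simp only [snoc, init, Fin.snoc_castSucc]
    · simp only [snoc, Fin.snoc_last]

theorem card_withCont_zero (ρ : Fin 0 → ℕ → ℕ) :
    Nat.card (WithCont α ρ) = if α = fun _ => 0 then 1 else 0 := by
  split_ifs with h
  · subst h
    rw [Nat.card_eq_one_iff_unique]
    refine ⟨⟨fun M N => Subtype.ext (ext' ?_ (funext fun k => k.elim0))⟩,
      ⟨⟨⟨fun _ _ => 0, by simp, by simp, by simp, fun k => k.elim0, fun k => k.elim0,
        fun k => k.elim0⟩, fun k => k.elim0⟩⟩⟩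
    funext k i
    obtain rfl : k = 0 := Fin.fin_one_eq_zero k
    rw [M.1.zero, N.1.zero]
  · rw [Nat.card_eq_zero]
    refine Or.inl ⟨fun M => h (funext fun i => ?_)⟩
    exact (M.1.last i).symm.trans (M.1.zero i)

theorem finite (hα : ∀ i, α (i + 1) ≤ α i) (hz : ∀ i, n ≤ i → α i = 0) :
    Finite (LRMultiF r α) := by
  have hanti : ∀ (M : LRMultiF r α) k i, M.chain k (i + 1) ≤ M.chain k i :=
    fun M k i => M.antitone k _ _ (Nat.le_succ i)
  have hα0 : ∀ (M : LRMultiF r α) k i, M.chain k i < α 0 + 1 := fun M k i =>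
    Nat.lt_succ_of_le ((M.chain_le k i).trans (antitone_nat_of_succ_le hα (Nat.zero_le i)))
  have hT : ∀ (M : LRMultiF r α) k i j, M.T k i j ≤ i := by
    intro M k i j
    by_cases h : M.chain k.castSucc i ≤ j ∧ j < M.chain k.succ i
    · exact (M.lr k).entry_le (hanti M _) i j h.1 h.2
    · rw [(M.lr k).1 i j h]
      exact Nat.zero_le i
  let f : LRMultiF r α → (Fin (r + 1) → Fin n → Fin (α 0 + 1)) ×
      (Fin r → Fin n → Fin (α 0) → Fin n) := fun M =>
    (fun k i => ⟨M.chain k i, hα0 M k i⟩,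
      fun k i j => ⟨M.T k i j, (hT M k i j).trans_lt i.2⟩)
  refine Finite.of_injective f fun M N h => ext' ?_ ?_
  · funext k i
    by_cases hi : n ≤ i
    · rw [M.chain_eq_zero hz _ _ hi, N.chain_eq_zero hz _ _ hi]
    · have := congrFun (congrFun (congrArg Prod.fst h) k) ⟨i, not_le.1 hi⟩
      simpa [f] using this
  · funext k i j
    have hout : ∀ M : LRMultiF r α, n ≤ i ∨ α 0 ≤ j → M.T k i j = 0 := by
      intro M hij
      refine (M.lr k).1 i j fun hc => ?_
      rcases hij with hi | hj
      · have := M.chain_eq_zero hz k.succ i hi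
        omega
      · have := M.chain_le k.succ i
        have := antitone_nat_of_succ_le hα (Nat.zero_le i)
        omega
    by_cases hij : n ≤ i ∨ α 0 ≤ j
    · rw [hout M hij, hout N hij]
    · push Not at hij
      have := congrFun (congrFun (congrFun (congrArg Prod.snd h) k) ⟨i, hij.1⟩) ⟨j, hij.2⟩
      simpa [f] using this

theorem card_withCont_succ {s m : ℕ} (hα : IsPar n (s + m) α) (ρ : Fin (r + 1) → ℕ → ℕ)
    (hρ : IsPar n m (ρ (Fin.last r))) :
    Nat.card (WithCont α ρ) = ∑ β ∈ parSet n s,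
      Nat.card (WithCont β fun k => ρ k.castSucc) * lrCoeff n β α (ρ (Fin.last r)) := by
  have hfin := finite (r := r + 1) hα.anti hα.zero
  have hlast : ∀ M : LRMultiF (r + 1) α, M.chain (Fin.last r).succ = α := fun M => funext M.last
  have hmem : ∀ M : WithCont α ρ, M.1.chain (Fin.last r).castSucc ∈ parSet n s := by
    intro M
    rw [mem_parSet]
    refine ⟨fun i => M.1.antitone _ _ _ (Nat.le_succ i), M.1.chain_eq_zero hα.zero _, ?_⟩
    have h1 := (M.1.isPar_cont hα.zero (Fin.last r)).sum
    rw [M.2, hρ.sum, size, hlast] at h1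
    have h2 := sum_add_skewSize hα.anti hα.zero (M.1.chain_le (Fin.last r).castSucc)
    rw [hα.sum] at h2
    omega
  let f : WithCont α ρ → parSet n s := fun M => ⟨_, hmem M⟩
  rw [Nat.card_congr (Equiv.sigmaFiberEquiv f).symm, Nat.card_sigma,
    ← Finset.sum_coe_sort (parSet n s) fun β =>
      Nat.card (WithCont β fun k => ρ k.castSucc) * lrCoeff n β α (ρ (Fin.last r))]
  refine Finset.sum_congr rfl fun β _ => ?_
  obtain ⟨β, hβ⟩ := β
  rw [mem_parSet] at hβ
  rw [Nat.card_congr (Equiv.subtypeEquivRight fun M => Subtype.ext_iff :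
    {M // f M = ⟨β, mem_parSet.2 hβ⟩} ≃ {M : WithCont α ρ // M.1.chain (Fin.last r).castSucc = β})]
  by_cases hle : ∀ i, β i ≤ α i
  · rw [Nat.card_congr (withContEquiv hα.anti hle ρ), Nat.card_prod,
      card_isLR_eq_lrCoeff hβ.anti hα.anti hα.zero hle]
  · have h0 : lrCoeff n β α (ρ (Fin.last r)) = 0 := by
      rw [lrCoeff, Finset.card_eq_zero, Finset.filter_eq_empty_iff]
      intro A hA
      rw [mem_hChains hα.zero] at hA
      refine absurd (fun i => ?_) hle
      rw [← hA.init]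
      exact hA.isShapeChain.le_final 0 i
    rw [h0, mul_zero, Nat.card_eq_zero]
    refine Or.inl ⟨?_⟩
    rintro ⟨M, rfl⟩
    exact hle (M.1.chain_le _)

end LRMultiF

theorem alternant_mul_prod_jacobiTrudi {R : Type*} [CommRing R] {n r : ℕ} (ν : Fin r → ℕ)
    (ρ : Fin r → ℕ → ℕ) (hρ : ∀ k, IsPar n (ν k) (ρ k)) (v : Fin n → R) :
    alternant v (shift n fun _ => 0) * ∏ k, jacobiTrudi (ν k) (ρ k) v =
      ∑ α ∈ parSet n (∑ k, ν k),
        (Nat.card (LRMultiF.WithCont α ρ) : R) * alternant v (shift n α) := by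
  induction r with
  | zero =>
    have h0 : parSet n (∑ k, ν k) = {fun _ => 0} := by
      ext α
      rw [mem_parSet, Finset.mem_singleton, Fin.sum_univ_zero]
      refine ⟨fun h => funext fun i => ?_, fun h => h ▸ isPar_zero n⟩
      by_cases hi : n ≤ i
      · exact h.zero i hi
      · exact Finset.sum_eq_zero_iff.1 h.sum i (Finset.mem_range.2 (not_le.1 hi))
    rw [h0, Finset.sum_singleton, LRMultiF.card_withCont_zero]
    simp
  | succ r ih =>
    rw [Fin.prod_univ_castSucc, ← mul_assoc, ih _ _ fun k => hρ k.castSucc, Finset.sum_mul,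
      Fin.sum_univ_castSucc]
    have h1 : ∀ β ∈ parSet n (∑ k : Fin r, ν k.castSucc),
        (Nat.card (LRMultiF.WithCont β fun k => ρ k.castSucc) : R) * alternant v (shift n β) *
          jacobiTrudi (ν (Fin.last r)) (ρ (Fin.last r)) v =
        ∑ α ∈ parSet n (∑ k : Fin r, ν k.castSucc + ν (Fin.last r)),
          (Nat.card (LRMultiF.WithCont β fun k => ρ k.castSucc) : R) *
            ((lrCoeff n β α (ρ (Fin.last r)) : R) * alternant v (shift n α)) := by
      intro β hβ
      rw [mul_assoc, alternant_mul_jacobiTrudi (mem_parSet.1 hβ) (hρ _), Finset.mul_sum]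
    rw [Finset.sum_congr rfl h1, Finset.sum_comm]
    refine Finset.sum_congr rfl fun α hα => ?_
    rw [LRMultiF.card_withCont_succ (mem_parSet.1 hα) ρ (hρ _), Nat.cast_sum, Finset.sum_mul]
    refine Finset.sum_congr rfl fun β _ => ?_
    push_cast
    ring

theorem lrStarNum_eq {n r : ℕ} {α β : ℕ → ℕ} (hα : ∀ i, α (i + 1) ≤ α i)
    (hz : ∀ i, n ≤ i → α i = 0) (hβ : ∀ i, β (i + 1) ≤ β i) (hz' : ∀ i, n ≤ i → β i = 0)
    (ν : Fin r → ℕ) (hν : ∀ k, ν k ≤ n) :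
    lrStarNum n r α β ν = ∑ ρ ∈ Fintype.piFinset fun k => parSet n (ν k),
      Nat.card (LRMultiF.WithCont α ρ) *
        Nat.card (LRMultiF.WithCont β fun k => conjFun n (ρ k)) := by
  have := LRMultiF.finite (r := r) hα hz
  have := LRMultiF.finite (r := r) hβ hz'
  have hsize : ∀ {γ : ℕ → ℕ}, (∀ i, n ≤ i → γ i = 0) → ∀ (M : LRMultiF r γ) k m,
      IsPar n m (M.cont k) → M.size k = m := fun hγ M k m h =>
    (M.isPar_cont hγ k).sum.symm.trans h.sum
  have hfin : Finite (LRPairsStar n r α β ν) := by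
    unfold LRPairsStar
    infer_instance
  let f : LRPairsStar n r α β ν → Fintype.piFinset fun k => parSet n (ν k) := fun M =>
    ⟨M.1.1.cont, Fintype.mem_piFinset.2 fun k => mem_parSet.2 <| by
      rw [← M.2.1 k]
      exact M.1.1.isPar_cont hz k⟩
  rw [lrStarNum, Nat.card_congr (Equiv.sigmaFiberEquiv f).symm, Nat.card_sigma,
    ← Finset.sum_coe_sort (Fintype.piFinset fun k => parSet n (ν k)) fun ρ =>
      Nat.card (LRMultiF.WithCont α ρ) *
        Nat.card (LRMultiF.WithCont β fun k => conjFun n (ρ k))]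
  refine Finset.sum_congr rfl fun ρ _ => ?_
  rw [← Nat.card_prod]
  have hρ : ∀ k, IsPar n (ν k) (ρ.1 k) := fun k =>
    mem_parSet.1 (Fintype.mem_piFinset.1 ρ.2 k)
  refine Nat.card_congr
    { toFun := fun M => ⟨⟨M.1.1.1, fun k => congrFun (congrArg Subtype.val M.2) k⟩,
        ⟨M.1.1.2, fun k => ?_⟩⟩
      invFun := fun M => ⟨⟨⟨M.1.1, M.2.1⟩, fun k => hsize hz _ _ _ (M.1.2 k ▸ hρ k),
        fun k => hsize hz' _ _ _ (M.2.2 k ▸ (hρ k).conj (hν k)), fun k m => by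
          rw [M.1.2, M.2.2]⟩, Subtype.ext (funext M.1.2)⟩
      left_inv := fun M => rfl
      right_inv := fun M => rfl }
  have h : M.1.1.1.cont k = ρ.1 k := congrFun (congrArg Subtype.val M.2) k
  exact (funext fun m => M.1.2.2.2 k m).trans (congrArg (conjFun n) h)

/-! ### Coefficient extraction -/

theorem mul_prod_eq_mul_prod {ι R : Type*} [CommRing R] (s : Finset ι) (u : R) (f g : ι → R)
    (h : ∀ k ∈ s, u * f k = u * g k) : u * ∏ k ∈ s, f k = u * ∏ k ∈ s, g k := by
  induction s using Finset.induction_on with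
  | empty => rfl
  | insert k s hk ih =>
    rw [Finset.prod_insert hk, Finset.prod_insert hk, ← mul_assoc,
      h k (Finset.mem_insert_self _ _), mul_right_comm,
      ih fun k hk => h k (Finset.mem_insert_of_mem hk)]
    ring

theorem alternant_mul_alternant_mul_prod_dualCauchy {R : Type*} [CommRing R] {n r : ℕ}
    (ν : Fin r → ℕ) (hν : ∀ k, ν k ≤ n) (x y : Fin n → R) :
    alternant x (shift n fun _ => 0) * alternant y (shift n fun _ => 0) *
        ∏ k, dualCauchy (ν k) x y =
      ∑ ρ ∈ Fintype.piFinset fun k => parSet n (ν k),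
        (∑ α ∈ parSet n (∑ k, ν k),
          (Nat.card (LRMultiF.WithCont α ρ) : R) * alternant x (shift n α)) *
        ∑ β ∈ parSet n (∑ k, ν k),
          (Nat.card (LRMultiF.WithCont β fun k => conjFun n (ρ k)) : R) *
            alternant y (shift n β) := by
  rw [mul_prod_eq_mul_prod Finset.univ _ _ (fun k => ∑ b ∈ parSet n (ν k),
    jacobiTrudi (ν k) b x * jacobiTrudi (ν k) (conjFun n b) y), Finset.prod_univ_sum,
    Finset.mul_sum]
  · refine Finset.sum_congr rfl fun ρ hρ => ?_
    have hρ' : ∀ k, IsPar n (ν k) (ρ k) := fun k => mem_parSet.1 (Fintype.mem_piFinset.1 hρ k)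
    rw [← alternant_mul_prod_jacobiTrudi ν ρ hρ', ← alternant_mul_prod_jacobiTrudi ν _ fun k =>
      (hρ' k).conj (hν k), Finset.prod_mul_distrib]
    ring
  · intro k _
    rw [alternant_mul_alternant_mul_dualCauchy (hν k), Finset.mul_sum]
    refine Finset.sum_congr rfl fun b hb => ?_
    rw [mem_parSet] at hb
    rw [← alternant_zero_mul_jacobiTrudi hb, ← alternant_zero_mul_jacobiTrudi (hb.conj (hν k))]
    ring

/-- The subsets of a three-dimensional box with prescribed plane sums in one direction. -/
def layerSets (n : ℕ) {r : ℕ} (ν : Fin r → ℕ) : Finset (Finset (Fin n × Fin n × Fin r)) :=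
  {E | ∀ k, #{e ∈ E | e.2.2 = k} = ν k}

theorem prod_dualCauchy_eq_sum {R : Type*} [CommRing R] {n r : ℕ} (ν : Fin r → ℕ)
    (x y : Fin n → R) :
    ∏ k, dualCauchy (ν k) x y = ∑ E ∈ layerSets n ν,
      (∏ i, x i ^ #{e ∈ E | e.1 = i}) * ∏ j, y j ^ #{e ∈ E | e.2.1 = j} := by
  simp only [dualCauchy]
  rw [Finset.prod_univ_sum]
  have hlayer : ∀ (B : Fin r → Finset (Fin n × Fin n)) k,
      (({e | (e.1, e.2.1) ∈ B e.2.2} : Finset (Fin n × Fin n × Fin r)).filter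
        fun e => e.2.2 = k) = (B k).image fun p => (p.1, p.2, k) := by
    intro B k
    ext ⟨i, j, l⟩
    simp only [Finset.mem_filter, Finset.mem_univ, true_and, Finset.mem_image, Prod.mk.injEq,
      Prod.exists]
    constructor
    · rintro ⟨h, rfl⟩
      exact ⟨i, j, h, rfl, rfl, rfl⟩
    · rintro ⟨i, j, h, rfl, rfl, rfl⟩
      exact ⟨h, rfl⟩
  have hinj : ∀ k : Fin r, Function.Injective fun p : Fin n × Fin n => (p.1, p.2, k) := by
    rintro k ⟨i, j⟩ ⟨i', j'⟩ h
    simpa using h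
  refine Finset.sum_bij' (fun B _ => ({e | (e.1, e.2.1) ∈ B e.2.2} :
    Finset (Fin n × Fin n × Fin r)))
    (fun E _ k => {p | (p.1, p.2, k) ∈ E}) ?_ ?_ ?_ ?_ ?_
  · intro B hB
    rw [layerSets, Finset.mem_filter]
    refine ⟨Finset.mem_univ _, fun k => ?_⟩
    rw [hlayer, Finset.card_image_of_injective _ (hinj k)]
    exact (Finset.mem_powersetCard.1 (Fintype.mem_piFinset.1 hB k)).2
  · intro E hE
    rw [layerSets, Finset.mem_filter] at hE
    rw [Fintype.mem_piFinset]
    intro k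
    rw [Finset.mem_powersetCard]
    refine ⟨Finset.subset_univ _, ?_⟩
    rw [← hE.2 k, ← Finset.card_image_of_injective _ (hinj k),
      ← hlayer fun k => ({p | (p.1, p.2, k) ∈ E} : Finset (Fin n × Fin n))]
    simp
  · intro B _
    funext k
    ext p
    simp
  · intro E _
    ext e
    simp
  · intro B _
    have hpow : ∀ {κ : Type} (s : Finset κ) (f : κ → Fin n) (w : Fin n → R),
        ∏ e ∈ s, w (f e) = ∏ i, w i ^ #{e ∈ s | f e = i} := by
      intro κ s f w
      rw [← Finset.prod_fiberwise' s f w]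
      exact Finset.prod_congr rfl fun i _ => Finset.prod_const _
    rw [← hpow _ (fun e : Fin n × Fin n × Fin r => e.1) x,
      ← hpow _ (fun e : Fin n × Fin n × Fin r => e.2.1) y, ← Finset.prod_mul_distrib,
      ← Finset.prod_fiberwise _ fun e : Fin n × Fin n × Fin r => e.2.2]
    refine Finset.prod_congr rfl fun k _ => ?_
    rw [hlayer, Finset.prod_image fun p _ q _ h => hinj k h]

/-- The exponent of a monomial in two sets of variables. -/
def expo {n : ℕ} (p q : Fin n → ℕ) : (Fin n ⊕ Fin n) →₀ ℕ :=
  Finsupp.equivFunOnFinite.symm (Sum.elim p q)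

theorem expo_inj {n : ℕ} {p q p' q' : Fin n → ℕ} :
    expo p q = expo p' q' ↔ p = p' ∧ q = q' := by
  rw [expo, expo, EmbeddingLike.apply_eq_iff_eq, Sum.elim_eq_iff]

theorem coeff_expo {n : ℕ} (p q p' q' : Fin n → ℕ) :
    MvPolynomial.coeff (expo p q)
        ((∏ i, (MvPolynomial.X (Sum.inl i) : MvPolynomial (Fin n ⊕ Fin n) ℚ) ^ p' i) *
          ∏ j, MvPolynomial.X (Sum.inr j) ^ q' j) = if p' = p ∧ q' = q then 1 else 0 := by
  have : (∏ i, (MvPolynomial.X (Sum.inl i) : MvPolynomial (Fin n ⊕ Fin n) ℚ) ^ p' i) *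
      ∏ j, MvPolynomial.X (Sum.inr j) ^ q' j = MvPolynomial.monomial (expo p' q') 1 := by
    rw [MvPolynomial.monomial_eq, Finsupp.prod_fintype _ _ fun i => pow_zero _,
      Fintype.prod_sum_type, map_one, one_mul]
    rfl
  rw [this, MvPolynomial.coeff_monomial]
  simp only [expo_inj]

theorem coeff_sign_mul {n : ℕ} (σ τ : Perm (Fin n)) (e : (Fin n ⊕ Fin n) →₀ ℕ)
    (f : MvPolynomial (Fin n ⊕ Fin n) ℚ) :
    MvPolynomial.coeff e (((Perm.sign σ : ℤ) : MvPolynomial (Fin n ⊕ Fin n) ℚ) *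
        ((Perm.sign τ : ℤ) : MvPolynomial (Fin n ⊕ Fin n) ℚ) * f) =
      ((Perm.sign σ : ℤ) : ℚ) * ((Perm.sign τ : ℤ) : ℚ) * MvPolynomial.coeff e f := by
  rw [← MvPolynomial.coeff_C_mul]
  simp

theorem coeff_alternant_mul_alternant_mul {n : ℕ} (p q l l' s t : Fin n → ℕ) :
    MvPolynomial.coeff (expo p q)
        (alternant (fun i => (MvPolynomial.X (Sum.inl i) : MvPolynomial (Fin n ⊕ Fin n) ℚ)) l *
          alternant (fun j => MvPolynomial.X (Sum.inr j)) l' *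
          ((∏ i, MvPolynomial.X (Sum.inl i) ^ s i) * ∏ j, MvPolynomial.X (Sum.inr j) ^ t j)) =
      ∑ σ : Perm (Fin n), ∑ τ : Perm (Fin n),
        ((Perm.sign σ : ℤ) : ℚ) * ((Perm.sign τ : ℤ) : ℚ) *
          if l ∘ σ + s = p ∧ l' ∘ τ + t = q then 1 else 0 := by
  rw [alternant_eq_sum, alternant_eq_sum, Finset.sum_mul_sum, Finset.sum_mul,
    MvPolynomial.coeff_sum]
  refine Finset.sum_congr rfl fun σ _ => ?_
  rw [Finset.sum_mul, MvPolynomial.coeff_sum]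
  refine Finset.sum_congr rfl fun τ _ => ?_
  rw [← coeff_expo p q (l ∘ σ + s) (l' ∘ τ + t), ← coeff_sign_mul]
  congr 1
  simp only [Pi.add_apply, pow_add, Finset.prod_mul_distrib, Function.comp_apply]
  ring

theorem coeff_alternant_mul_alternant {n : ℕ} (p q : Fin n → ℕ) (α β : ℕ → ℕ) :
    MvPolynomial.coeff (expo p q)
        (alternant (fun i => (MvPolynomial.X (Sum.inl i) : MvPolynomial (Fin n ⊕ Fin n) ℚ))
            (shift n α) * alternant (fun j => MvPolynomial.X (Sum.inr j)) (shift n β)) =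
      altCoeff ℚ n α p * altCoeff ℚ n β q := by
  have := coeff_alternant_mul_alternant_mul p q (shift n α) (shift n β) 0 0
  simp only [Pi.zero_apply, pow_zero, Finset.prod_const_one, mul_one, add_zero] at this
  rw [this, altCoeff, altCoeff, Finset.sum_mul_sum]
  refine Finset.sum_congr rfl fun σ _ => Finset.sum_congr rfl fun τ _ => ?_
  simp only [eq_comm (a := p), eq_comm (a := q)]
  split_ifs <;> simp_all

theorem sum_card_mul_altCoeff {n m : ℕ} {a : ℕ → ℕ} (ha : IsPar n m a) (f : (ℕ → ℕ) → ℚ) :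
    ∑ α ∈ parSet n m, f α * altCoeff ℚ n α (shift n a) = f a := by
  rw [Finset.sum_eq_single_of_mem a (mem_parSet.2 ha)]
  · rw [altCoeff_shift ℚ ha.anti ha.anti, if_pos fun _ _ => rfl, mul_one]
  · intro α hα hne
    rw [mem_parSet] at hα
    rw [altCoeff_shift ℚ hα.anti ha.anti, if_neg, mul_zero]
    refine fun h => hne (funext fun i => ?_)
    by_cases hi : i < n
    · exact (h i hi).symm
    · rw [hα.zero i (not_lt.1 hi), ha.zero i (not_lt.1 hi)]

theorem shift_comp_add_eq_iff {n : ℕ} {a : ℕ → ℕ} (σ : Perm (Fin n)) (s : Fin n → ℕ) :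
    shift n (fun _ => 0) ∘ σ + s = shift n a ↔
      ∀ i : Fin n, (s i : ℤ) = (a i : ℤ) - i + ((σ i : Fin n) : ℕ) := by
  rw [funext_iff]
  refine forall_congr' fun i => ?_
  have := i.2
  have := (σ i).2
  simp only [shift, Pi.add_apply, Function.comp_apply]
  omega

theorem sum_sign_mul_card_eq {n r : ℕ} {a b : ℕ → ℕ} (ha : IsPar n n a) (hb : IsPar n n b)
    (ν : Fin r → ℕ) (hν : ∑ k, ν k = n) :
    (lrStarNum n r a b ν : ℚ) = ∑ σ : Perm (Fin n), ∑ τ : Perm (Fin n),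
      ((Perm.sign σ : ℤ) : ℚ) * ((Perm.sign τ : ℤ) : ℚ) *
        #{E ∈ layerSets n ν | (∀ i : Fin n, (#{e ∈ E | e.1 = i} : ℤ) = a i - i + (σ i : ℕ)) ∧
          ∀ j : Fin n, (#{e ∈ E | e.2.1 = j} : ℤ) = b j - j + (τ j : ℕ)} := by
  have hνn : ∀ k, ν k ≤ n := fun k => by
    rw [← hν]
    exact Finset.single_le_sum (f := ν) (fun _ _ => Nat.zero_le _) (Finset.mem_univ k)
  have key := congrArg (MvPolynomial.coeff (expo (shift n a) (shift n b)))
    (alternant_mul_alternant_mul_prod_dualCauchy ν hνn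
      (fun i => (MvPolynomial.X (Sum.inl i) : MvPolynomial (Fin n ⊕ Fin n) ℚ))
      fun j => MvPolynomial.X (Sum.inr j))
  rw [hν, prod_dualCauchy_eq_sum, Finset.mul_sum, MvPolynomial.coeff_sum,
    MvPolynomial.coeff_sum] at key
  rw [lrStarNum_eq ha.anti ha.zero hb.anti hb.zero ν hνn]
  push_cast
  trans
  · refine (Finset.sum_congr rfl fun ρ _ => ?_).trans key.symm
    rw [Finset.sum_mul_sum, MvPolynomial.coeff_sum,
      ← sum_card_mul_altCoeff ha fun α => (Nat.card (LRMultiF.WithCont α ρ) : ℚ),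
      ← sum_card_mul_altCoeff hb fun β =>
        (Nat.card (LRMultiF.WithCont β fun k => conjFun n (ρ k)) : ℚ), Finset.sum_mul_sum]
    refine Finset.sum_congr rfl fun α _ => ?_
    rw [MvPolynomial.coeff_sum]
    refine Finset.sum_congr rfl fun β _ => ?_
    rw [mul_mul_mul_comm, ← coeff_alternant_mul_alternant, ← MvPolynomial.coeff_C_mul]
    congr 1
    simp only [map_mul, map_natCast]
    ring
  · simp only [coeff_alternant_mul_alternant_mul]
    rw [Finset.sum_comm]
    refine Finset.sum_congr rfl fun σ _ => ?_
    rw [Finset.sum_comm]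
    refine Finset.sum_congr rfl fun τ _ => ?_
    rw [← Finset.mul_sum, Finset.sum_boole]
    simp only [shift_comp_add_eq_iff]

/-! ### Signed counts of fixed colorings -/

theorem sum_sign_fixing {n : ℕ} {ι : Type*} (F : Fin n → ι) :
    ∑ g : Perm (Fin n), (if ∀ x, F (g x) = F x then ((Perm.sign g : ℤ) : ℚ) else 0) =
      if Function.Injective F then 1 else 0 := by
  split_ifs with hF
  · rw [Finset.sum_eq_single_of_mem 1 (Finset.mem_univ _)]
    · simp
    · intro g _ hg
      exact if_neg fun h => hg (Equiv.ext fun x => hF (h x))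
  · simp only [Function.Injective, not_forall] at hF
    obtain ⟨i, j, hij, hne⟩ := hF
    have hswap : ∀ x, F (Equiv.swap i j x) = F x := by
      intro x
      by_cases h1 : x = i
      · rw [h1, Equiv.swap_apply_left, hij]
      · by_cases h2 : x = j
        · rw [h2, Equiv.swap_apply_right, hij]
        · rw [Equiv.swap_apply_of_ne_of_ne h1 h2]
    have h := Equiv.sum_comp (Equiv.mulLeft (Equiv.swap i j)) fun g : Perm (Fin n) =>
      if ∀ x, F (g x) = F x then ((Perm.sign g : ℤ) : ℚ) else 0
    have h2 : ∀ g : Perm (Fin n), (if ∀ x, F ((Equiv.mulLeft (Equiv.swap i j) g) x) = F x then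
        ((Perm.sign (Equiv.mulLeft (Equiv.swap i j) g) : ℤ) : ℚ) else 0) =
        -if ∀ x, F (g x) = F x then ((Perm.sign g : ℤ) : ℚ) else 0 := by
      intro g
      simp only [Equiv.coe_mulLeft, Perm.mul_apply, hswap, Perm.sign_mul, Perm.sign_swap hne]
      split_ifs <;> simp
    rw [Finset.sum_congr rfl fun g _ => h2 g, Finset.sum_neg_distrib] at h
    linarith

theorem sum_sign_mul_card_fixed {n : ℕ} {ι : Type*} [Fintype ι] (P : (Fin n → ι) → Prop) :
    ∑ g : Perm (Fin n), (#{F : Fin n → ι | P F ∧ ∀ x, F (g x) = F x} : ℚ) *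
        ((Perm.sign g : ℤ) : ℚ) =
      #{F : Fin n → ι | P F ∧ Function.Injective F} := by
  simp only [Finset.card_filter, Nat.cast_sum, Finset.sum_mul]
  rw [Finset.sum_comm]
  refine Finset.sum_congr rfl fun F _ => ?_
  by_cases hF : P F
  · simpa [hF] using sum_sign_fixing F
  · simp [hF]

/-- Injective functions with a given image are bijections onto it. -/
def injectiveImageEquiv {κ ι : Type*} [Fintype κ] (E : Finset ι) :
    {F : κ → ι // Function.Injective F ∧ Finset.univ.image F = E} ≃ (κ ≃ E) where
  toFun F := Equiv.ofBijective
    (fun x => ⟨F.1 x, (Finset.ext_iff.1 F.2.2 _).1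
      (Finset.mem_image_of_mem F.1 (Finset.mem_univ x))⟩)
    ⟨fun x y h => F.2.1 (congrArg Subtype.val h), fun y => by
      obtain ⟨x, -, hx⟩ := Finset.mem_image.1 ((Finset.ext_iff.1 F.2.2 y).2 y.2)
      exact ⟨x, Subtype.ext hx⟩⟩
  invFun e := ⟨fun x => e x, fun x y h => e.injective (Subtype.ext h), by
    ext y
    simp only [Finset.mem_image, Finset.mem_univ, true_and]
    exact ⟨fun ⟨x, hx⟩ => hx ▸ (e x).2, fun hy => ⟨e.symm ⟨y, hy⟩, by simp⟩⟩⟩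
  left_inv F := rfl
  right_inv e := by
    ext x
    rfl

theorem card_injective_image {n : ℕ} {ι : Type*} [Fintype ι] (Q : Finset ι → Prop)
    (hQ : ∀ E, Q E → #E = n) :
    #{F : Fin n → ι | Q (Finset.univ.image F) ∧ Function.Injective F} =
      n.factorial * #{E : Finset ι | Q E} := by
  rw [Finset.card_eq_sum_card_fiberwise (f := fun F : Fin n → ι => Finset.univ.image F)
    (t := ({E : Finset ι | Q E} : Finset (Finset ι)))
    fun F hF => by simpa using (by simpa using hF : _ ∧ _).1,
    Finset.sum_const_nat (m := n.factorial), mul_comm]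
  intro E hE
  have hQE : Q E := by simpa using hE
  have e : Fin n ≃ E := (Finset.equivFinOfCardEq (hQ E hQE)).symm
  have h := Fintype.card_congr (injectiveImageEquiv (κ := Fin n) E)
  rw [Fintype.card_equiv e, Fintype.card_fin, Fintype.card_subtype] at h
  rw [← h, Finset.filter_filter]
  refine congrArg _ (Finset.filter_congr fun F _ => ?_)
  constructor
  · rintro ⟨⟨-, h1⟩, h2⟩
    exact ⟨h1, h2⟩
  · rintro ⟨h1, h2⟩
    exact ⟨⟨h2 ▸ hQE, h1⟩, h2⟩

theorem permChar_eq_card {n p : ℕ} {c : ℕ → ℕ} (hc : ∀ k, p ≤ k → c k = 0) (g : Perm (Fin n)) :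
    permChar n c g =
      #{f : Fin n → Fin p | (∀ k : Fin p, #{x | f x = k} = c k) ∧ ∀ x, f (g x) = f x} := by
  rw [permChar, ← Fintype.card_coe, ← Nat.card_eq_fintype_card]
  congr 1
  have hcard : ∀ (f : Fin n → ℕ) k, Nat.card {x : Fin n // f x = k} = #{x | f x = k} :=
    fun f k => by rw [Nat.card_eq_fintype_card, Fintype.card_subtype]
  have hlt : ∀ f : Fin n → ℕ, (∀ k, Nat.card {x : Fin n // f x = k} = c k) → ∀ x, f x < p := by
    intro f hf x
    by_contra hx
    have h := hf (f x)
    rw [hc _ (not_lt.1 hx), hcard, Finset.card_eq_zero, Finset.filter_eq_empty_iff] at h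
    exact h (Finset.mem_univ x) rfl
  refine Nat.card_congr
    { toFun := fun f => ⟨fun x => ⟨f.1 x, hlt f.1 f.2.1 x⟩, ?_⟩
      invFun := fun f => ⟨fun x => f.1 x, ?_⟩
      left_inv := fun f => rfl
      right_inv := fun f => rfl }
  · simp only [Finset.mem_filter, Finset.mem_univ, true_and, Fin.ext_iff]
    exact ⟨fun k => by rw [← f.2.1 k, hcard], fun x => f.2.2 x⟩
  · have hf := f.2
    simp only [Finset.mem_filter, Finset.mem_univ, true_and, Fin.ext_iff] at hf
    refine ⟨fun k => ?_, hf.2⟩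
    rw [hcard]
    by_cases hk : k < p
    · exact hf.1 ⟨k, hk⟩
    · rw [hc k (not_lt.1 hk), Finset.card_eq_zero, Finset.filter_eq_empty_iff]
      intro x _ hx
      exact hk (hx ▸ (f.1 x).2)

theorem permCharZ_eq_card {n p : ℕ} {c : ℕ → ℤ} (hc : ∀ k, p ≤ k → c k = 0)
    (g : Perm (Fin n)) :
    permCharZ n c g =
      #{f : Fin n → Fin p | (∀ k : Fin p, (#{x | f x = k} : ℤ) = c k) ∧ ∀ x, f (g x) = f x} := by
  unfold permCharZ
  split_ifs with h
  · rw [permChar_eq_card (p := p) fun k hk => by rw [hc k hk]; rfl]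
    congr 2
    refine Finset.filter_congr fun f _ => and_congr_left fun _ => forall_congr' fun k => ?_
    have := h k
    omega
  · symm
    rw [Nat.cast_eq_zero, Finset.card_eq_zero, Finset.filter_eq_empty_iff]
    intro f _ hf
    refine h fun k => ?_
    by_cases hk : k < p
    · rw [← hf.1 ⟨k, hk⟩]
      positivity
    · rw [hc k (not_lt.1 hk)]

theorem card_fixed_mul_card_fixed_mul_card_fixed {n : ℕ} {X Y Z : Type*} [Fintype X] [Fintype Y]
    [Fintype Z] (g : Perm (Fin n)) (P : (Fin n → X) → Prop) (Q : (Fin n → Y) → Prop)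
    (S : (Fin n → Z) → Prop) :
    #{f : Fin n → X | P f ∧ ∀ x, f (g x) = f x} * #{f : Fin n → Y | Q f ∧ ∀ x, f (g x) = f x} *
        #{f : Fin n → Z | S f ∧ ∀ x, f (g x) = f x} =
      #{F : Fin n → X × Y × Z | (P (fun x => (F x).1) ∧ Q (fun x => (F x).2.1) ∧
        S fun x => (F x).2.2) ∧ ∀ x, F (g x) = F x} := by
  rw [mul_assoc, ← Finset.card_product, ← Finset.card_product]
  refine Finset.card_bij' (fun f _ x => (f.1 x, f.2.1 x, f.2.2 x))
    (fun F _ => (fun x => (F x).1, fun x => (F x).2.1, fun x => (F x).2.2)) ?_ ?_ ?_ ?_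
  · intro f hf
    simp only [Finset.mem_product, Finset.mem_filter, Finset.mem_univ, true_and] at hf ⊢
    exact ⟨⟨hf.1.1, hf.2.1.1, hf.2.2.1⟩, fun x => by rw [hf.1.2, hf.2.1.2, hf.2.2.2]⟩
  · intro F hF
    simp only [Finset.mem_product, Finset.mem_filter, Finset.mem_univ, true_and] at hF ⊢
    exact ⟨⟨hF.1.1, fun x => by rw [hF.2]⟩, ⟨hF.1.2.1, fun x => by rw [hF.2]⟩, hF.1.2.2,
      fun x => by rw [hF.2]⟩
  · intro f _
    rfl
  · intro F _
    rfl

theorem card_fiber_image {n : ℕ} {ι κ : Type*} [DecidableEq κ] {F : Fin n → ι}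
    (hF : Function.Injective F) (π : ι → κ) (k : κ) :
    #{e ∈ Finset.univ.image F | π e = k} = #{x | π (F x) = k} := by
  rw [Finset.filter_image, Finset.card_image_of_injective _ hF]

theorem sum_sign_mul_card_mul_card_mul_card {n r : ℕ} (ν : Fin r → ℕ) (hν : ∑ k, ν k = n)
    (c d : Fin n → ℤ) :
    ∑ g : Perm (Fin n),
      (#{f : Fin n → Fin n | (∀ i, (#{x | f x = i} : ℤ) = c i) ∧ ∀ x, f (g x) = f x} : ℚ) *
        #{f : Fin n → Fin n | (∀ j, (#{x | f x = j} : ℤ) = d j) ∧ ∀ x, f (g x) = f x} *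
        #{f : Fin n → Fin r | (∀ k, #{x | f x = k} = ν k) ∧ ∀ x, f (g x) = f x} *
        ((Perm.sign g : ℤ) : ℚ) =
      n.factorial * #{E ∈ layerSets n ν | (∀ i : Fin n, (#{e ∈ E | e.1 = i} : ℤ) = c i) ∧
          ∀ j : Fin n, (#{e ∈ E | e.2.1 = j} : ℤ) = d j} := by
  have hfix : ∀ g : Perm (Fin n),
      (#{f : Fin n → Fin n | (∀ i, (#{x | f x = i} : ℤ) = c i) ∧ ∀ x, f (g x) = f x} : ℚ) *
        #{f : Fin n → Fin n | (∀ j, (#{x | f x = j} : ℤ) = d j) ∧ ∀ x, f (g x) = f x} *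
        #{f : Fin n → Fin r | (∀ k, #{x | f x = k} = ν k) ∧ ∀ x, f (g x) = f x} =
      #{F : Fin n → Fin n × Fin n × Fin r | ((∀ i, (#{x | (F x).1 = i} : ℤ) = c i) ∧
        (∀ j, (#{x | (F x).2.1 = j} : ℤ) = d j) ∧ ∀ k, #{x | (F x).2.2 = k} = ν k) ∧
        ∀ x, F (g x) = F x} := fun g => by
    have h := card_fixed_mul_card_fixed_mul_card_fixed g
      (fun f : Fin n → Fin n => ∀ i, (#{x | f x = i} : ℤ) = c i)
      (fun f : Fin n → Fin n => ∀ j, (#{x | f x = j} : ℤ) = d j)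
      (fun f : Fin n → Fin r => ∀ k, #{x | f x = k} = ν k)
    rw [← Nat.cast_mul, ← Nat.cast_mul]
    refine congrArg Nat.cast ?_
    convert h
  have hsum := sum_sign_mul_card_fixed fun F : Fin n → Fin n × Fin n × Fin r =>
    (∀ i, (#{x | (F x).1 = i} : ℤ) = c i) ∧
      (∀ j, (#{x | (F x).2.1 = j} : ℤ) = d j) ∧ ∀ k, #{x | (F x).2.2 = k} = ν k
  refine (Finset.sum_congr rfl fun g _ => ?_).trans (hsum.trans ?_)
  · rw [hfix g]
    congr!
  rw [layerSets, Finset.filter_filter]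
  have h := card_injective_image (n := n) (fun E : Finset (Fin n × Fin n × Fin r) =>
    (∀ k, #{e ∈ E | e.2.2 = k} = ν k) ∧ (∀ i : Fin n, (#{e ∈ E | e.1 = i} : ℤ) = c i) ∧
      ∀ j : Fin n, (#{e ∈ E | e.2.1 = j} : ℤ) = d j) fun E hE => by
    rw [Finset.card_eq_sum_card_fiberwise (f := fun e => e.2.2) (t := Finset.univ)
      fun _ _ => Finset.mem_coe.2 (Finset.mem_univ _)]
    exact (Finset.sum_congr rfl fun k _ => hE.1 k).trans hν
  rw [← Nat.cast_mul]
  refine (congrArg Nat.cast (Eq.trans ?_ h)).trans (by congr!)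
  congr 1
  ext F
  simp only [Finset.mem_filter, Finset.mem_univ, true_and]
  refine and_congr_left fun hF => ?_
  simp only [card_fiber_image hF]
  tauto

theorem isPar_of_isPartitionFun {n : ℕ} {a : ℕ → ℕ} (ha : IsPartitionFun n a) : IsPar n n a :=
  ⟨fun i => ha.1 i (i + 1) (Nat.le_succ i), ha.2.1, ha.2.2⟩

theorem irrChar_eq_sum_card (n : ℕ) (a : ℕ → ℕ) (g : Perm (Fin n)) :
    irrChar n a g = ∑ σ : Perm (Fin n), ((Perm.sign σ : ℤ) : ℚ) *
      #{f : Fin n → Fin n | (∀ i : Fin n, (#{x | f x = i} : ℤ) =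
        (a i : ℤ) - (i : ℕ) + ((σ i : Fin n) : ℕ)) ∧ ∀ x, f (g x) = f x} := by
  refine Finset.sum_congr rfl fun σ _ => ?_
  rw [permCharZ_eq_card (p := n) fun k hk => dif_neg (not_lt.2 hk)]
  simp only [Fin.is_lt, dite_true, Fin.eta]

end

/-- `lr*(a,b;ν) = ⟨χ^a ⊗ χ^b ⊗ φ^ν, χ^{(1^n)}⟩`. -/
theorem stmt9 (n r : ℕ) (a b : ℕ → ℕ) (ha : IsPartitionFun n a) (hb : IsPartitionFun n b)
    (ν : Fin r → ℕ) (hν : ∑ k, ν k = n) :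
    (lrStarNum n r a b ν : ℚ) =
      innerChar n (fun g => irrChar n a g * irrChar n b g * permChar n (extc ν) g)
        (signChar n) := by
  have hperm : ∀ g, permChar n (extc ν) g =
      #{f : Fin n → Fin r | (∀ k, #{x | f x = k} = ν k) ∧ ∀ x, f (g x) = f x} := fun g => by
    rw [permChar_eq_card (p := r) fun k hk => dif_neg (not_lt.2 hk)]
    simp only [extc, Fin.is_lt, dite_true, Fin.eta]
  have hexp : ∀ g, irrChar n a g * irrChar n b g * permChar n (extc ν) g * signChar n g =
      ∑ σ : Perm (Fin n), ∑ τ : Perm (Fin n), ((Perm.sign σ : ℤ) : ℚ) * ((Perm.sign τ : ℤ) : ℚ) *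
        (#{f : Fin n → Fin n | (∀ i : Fin n, (#{x | f x = i} : ℤ) =
            (a i : ℤ) - (i : ℕ) + ((σ i : Fin n) : ℕ)) ∧ ∀ x, f (g x) = f x} *
          #{f : Fin n → Fin n | (∀ j : Fin n, (#{x | f x = j} : ℤ) =
            (b j : ℤ) - (j : ℕ) + ((τ j : Fin n) : ℕ)) ∧ ∀ x, f (g x) = f x} *
          #{f : Fin n → Fin r | (∀ k, #{x | f x = k} = ν k) ∧ ∀ x, f (g x) = f x} *
          ((Perm.sign g : ℤ) : ℚ)) := fun g => by
    rw [irrChar_eq_sum_card, irrChar_eq_sum_card, hperm, Finset.sum_mul_sum]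
    simp only [Finset.sum_mul]
    refine Finset.sum_congr rfl fun σ _ => Finset.sum_congr rfl fun τ _ => ?_
    rw [signChar]
    ring
  rw [innerChar, eq_div_iff (by positivity),
    sum_sign_mul_card_eq (isPar_of_isPartitionFun ha) (isPar_of_isPartitionFun hb) ν hν,
    Finset.sum_congr rfl fun g _ => hexp g, Finset.sum_mul]
  refine (Finset.sum_congr rfl fun σ _ => ?_).trans Finset.sum_comm.symm
  rw [Finset.sum_mul]
  refine (Finset.sum_congr rfl fun τ _ => ?_).trans Finset.sum_comm.symm
  rw [← Finset.mul_sum, sum_sign_mul_card_mul_card_mul_card ν hν]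
  ring
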